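/- arXiv:1609.09033 — 4 statements merged into one kernel-verified Lean document; each statement's English description precedes it below -/
import Mathlib

section
/- Under the stated assumptions, the smoothed estimating-equation summand W_j = Z_j[G(−U_j/h) − q] satisfies, as h → 0⁺: E(W_j′W_j) = q(1−q) E(Z_j′Z_j) − h [1 − ∫_{−1}^{1} G(u)² du] E[ f_{U|Z}(0|Z_j) Z_j′Z_j ] + O(h²), and E(W_jW_j′) = q(1−q) E(Z_jZ_j′) − h [1 − ∫_{−1}^{1} G(u)² du] E[ f_{U|Z}(0|Z_j) Z_jZ_j′ ] + O(h²) (Theorem 1, second-moment part). -/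
open MeasureTheory Filter Topology Asymptotics

/-- the difference between the smoothed and the unsmoothed squared score -/
noncomputable def gDiff (G : ℝ → ℝ) (q h u : ℝ) : ℝ :=
  (G (-u / h) - q) ^ 2 - ((if u < 0 then (1 : ℝ) else 0) - q) ^ 2

lemma gDiff_meas {G : ℝ → ℝ} (hG : Continuous G) (q h : ℝ) : Measurable (gDiff G q h) := by
  unfold gDiff
  have h1 : Measurable fun u : ℝ => (if u < 0 then (1 : ℝ) else 0) :=
    Measurable.ite measurableSet_Iio measurable_const measurable_const
  have h2 : Measurable fun u : ℝ => G (-u / h) :=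
    hG.measurable.comp (measurable_neg.div_const h)
  exact ((h2.sub_const q).pow_const 2).sub ((h1.sub_const q).pow_const 2)

lemma gDiff_zero {G : ℝ → ℝ} (hG0 : ∀ v : ℝ, v ≤ -1 → G v = 0) (hG1 : ∀ v : ℝ, 1 ≤ v → G v = 1)
    (q : ℝ) {h u : ℝ} (hh : 0 < h) (hu : u ∉ Set.Ioo (-h) h) : gDiff G q h u = 0 := by
  unfold gDiff
  by_cases hneg : u < 0
  · have : u ≤ -h := by
      by_contra hc
      exact hu ⟨by linarith, by linarith⟩
    rw [hG1 (-u / h) (by rw [le_div_iff₀ hh]; linarith), if_pos hneg]; ring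
  · have : h ≤ u := by
      by_contra hc
      exact hu ⟨by linarith, by linarith⟩
    rw [hG0 (-u / h) (by rw [div_le_iff₀ hh]; linarith), if_neg hneg]; ring

lemma gDiff_bdd {G : ℝ → ℝ} {M q : ℝ} (hM : ∀ v, |G v| ≤ M) (hq : q ∈ Set.Ioo (0 : ℝ) 1)
    (h u : ℝ) : |gDiff G q h u| ≤ (M + 1) ^ 2 + 1 := by
  have hq0 := hq.1
  have hq1 := hq.2
  unfold gDiff
  have h1 := abs_le.1 (hM (-u / h))
  have a1 : (G (-u / h) - q) ^ 2 ≤ (M + 1) ^ 2 := by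
    apply sq_le_sq'  <;> linarith
  have a2 : ((if u < 0 then (1 : ℝ) else 0) - q) ^ 2 ≤ 1 := by
    split_ifs <;> nlinarith
  have a3 := sq_nonneg (G (-u / h) - q)
  have a4 := sq_nonneg ((if u < 0 then (1 : ℝ) else 0) - q)
  rw [abs_le]; constructor <;> nlinarith

lemma G_symm {G : ℝ → ℝ} (hGdiff : Differentiable ℝ G)
    (hG0 : ∀ v : ℝ, v ≤ -1 → G v = 0) (hG1 : ∀ v : ℝ, 1 ≤ v → G v = 1)
    (hG'even : ∀ v, deriv G (-v) = deriv G v) (v : ℝ) : G (-v) = 1 - G v := by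
  have hd : ∀ x, HasDerivAt (fun x => G x + G (-x)) 0 x := by
    intro x
    have h1 := (hGdiff x).hasDerivAt
    have h2 : HasDerivAt (fun x => G (-x)) (deriv G (-x) * (-1)) x :=
      HasDerivAt.comp x (hGdiff (-x)).hasDerivAt (hasDerivAt_neg x)
    have := h1.add h2
    rw [hG'even] at this
    have e0 : deriv G x + deriv G x * (-1) = 0 := by ring
    rw [e0] at this
    exact this
  have hc := is_const_of_deriv_eq_zero (fun x => (hd x).differentiableAt) (fun x => (hd x).deriv) v 1
  simp only [hG1 1 le_rfl, hG0 (-1) le_rfl] at hc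
  linarith

lemma G_int {G : ℝ → ℝ} (hGdiff : Differentiable ℝ G)
    (hG0 : ∀ v : ℝ, v ≤ -1 → G v = 0) (hG1 : ∀ v : ℝ, 1 ≤ v → G v = 1)
    (hG'even : ∀ v, deriv G (-v) = deriv G v) : ∫ v in (-1 : ℝ)..1, G v = 1 := by
  have h1 : ∫ v in (-1 : ℝ)..1, G (-v) = ∫ v in (-1 : ℝ)..1, G v := by
    rw [intervalIntegral.integral_comp_neg]; simp
  have h2 : ∫ v in (-1 : ℝ)..1, G (-v) = ∫ v in (-1 : ℝ)..1, (1 - G v) := by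
    congr 1; ext v; exact G_symm hGdiff hG0 hG1 hG'even v
  rw [intervalIntegral.integral_sub (by simp) (hGdiff.continuous.intervalIntegrable _ _)] at h2
  simp at h2
  linarith

lemma gDiff_integral {G : ℝ → ℝ} (hGdiff : Differentiable ℝ G)
    (hG0 : ∀ v : ℝ, v ≤ -1 → G v = 0) (hG1 : ∀ v : ℝ, 1 ≤ v → G v = 1)
    (hG'even : ∀ v, deriv G (-v) = deriv G v) (q : ℝ) {h ε : ℝ} (hh : 0 < h) (hhε : h ≤ ε) :
    ∫ u in Set.Ioo (-ε) ε, gDiff G q h u = - (h * (1 - ∫ u in (-1 : ℝ)..1, (G u) ^ 2)) := by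
  have hGc := hGdiff.continuous
  have hh0 : h ≠ 0 := hh.ne'
  have e1 : ∫ u in Set.Ioo (-ε) ε, gDiff G q h u = ∫ u in Set.Ioo (-h) h, gDiff G q h u := by
    apply setIntegral_eq_of_subset_of_forall_sdiff_eq_zero measurableSet_Ioo
    · exact Set.Ioo_subset_Ioo (by linarith) hhε
    · intro x hx; exact gDiff_zero hG0 hG1 q hh hx.2
  have e2 : ∫ u in Set.Ioo (-h) h, gDiff G q h u = ∫ u in (-h)..h, gDiff G q h u := by
    rw [intervalIntegral.integral_of_le (by linarith), integral_Ioc_eq_integral_Ioo]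
  have hI1 : IntervalIntegrable (fun u : ℝ => (G (-u / h) - q) ^ 2) volume (-h) h := by
    apply Continuous.intervalIntegrable; fun_prop
  have hs : ∀ a b : ℝ, IntervalIntegrable
      (fun u : ℝ => ((if u < 0 then (1 : ℝ) else 0) - q) ^ 2) volume a b := by
    intro a b
    have hm : Measurable fun u : ℝ => ((if u < 0 then (1 : ℝ) else 0) - q) ^ 2 :=
      ((Measurable.ite measurableSet_Iio measurable_const measurable_const).sub_const q).pow_const 2
    rw [intervalIntegrable_iff]
    apply Measure.integrableOn_of_bounded (M := (1 - q) ^ 2 + q ^ 2) (by simp [Set.uIoc])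
      hm.aestronglyMeasurable
    · refine Eventually.of_forall fun u => ?_
      rw [Real.norm_eq_abs, abs_of_nonneg (sq_nonneg _)]
      split_ifs <;> nlinarith [sq_nonneg (1-q), sq_nonneg q]
  have e3 : ∫ u in (-h)..h, (G (-u / h) - q) ^ 2
      = h * ((∫ u in (-1 : ℝ)..1, (G u) ^ 2) - 2 * q + 2 * q ^ 2) := by
    have : ∫ u in (-h)..h, (G (-u / h) - q) ^ 2 =
        ∫ u in (-h)..h, (fun v => (G v - q) ^ 2) (u / (-h)) := by
      congr 1; ext u; simp only [neg_div, div_neg]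
    rw [this, intervalIntegral.integral_comp_div (fun v => (G v - q) ^ 2) (neg_ne_zero.2 hh0)]
    have a1 : -h / -h = 1 := div_self (neg_ne_zero.2 hh0)
    have a2 : h / -h = -1 := by rw [div_neg, div_self hh0]
    rw [a1, a2, intervalIntegral.integral_symm]
    have a3 : ∫ v in (-1 : ℝ)..1, (G v - q) ^ 2
        = ∫ v in (-1 : ℝ)..1, ((G v) ^ 2 - 2 * q * G v + q ^ 2) := by
      congr 1; ext v; ring
    have c1 : IntervalIntegrable (fun v => (G v) ^ 2) volume (-1) 1 := by
      apply Continuous.intervalIntegrable; fun_prop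
    have c2 : IntervalIntegrable (fun v => 2 * q * G v) volume (-1) 1 := by
      apply Continuous.intervalIntegrable; fun_prop
    rw [a3, intervalIntegral.integral_add (c1.sub c2) (by simp), intervalIntegral.integral_sub c1 c2,
      intervalIntegral.integral_const_mul, G_int hGdiff hG0 hG1 hG'even]
    simp only [intervalIntegral.integral_const, smul_eq_mul]
    ring
  have e4 : ∫ u in (-h)..h, ((if u < 0 then (1 : ℝ) else 0) - q) ^ 2
      = h * (1 - q) ^ 2 + h * q ^ 2 := by
    rw [← intervalIntegral.integral_add_adjacent_intervals (hs (-h) 0) (hs 0 h)]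
    congr 1
    · rw [intervalIntegral.integral_of_le (by linarith), integral_Ioc_eq_integral_Ioo,
        setIntegral_congr_fun (g := fun _ => (1 - q) ^ 2) measurableSet_Ioo]
      · simp [hh.le]
      · intro u hu; simp only [if_pos hu.2]
    · rw [intervalIntegral.integral_of_le hh.le,
        setIntegral_congr_fun (g := fun _ => q ^ 2) measurableSet_Ioc]
      · simp [hh.le]
      · intro u hu; simp only [if_neg (not_lt.2 hu.1.le)]; ring
  rw [e1, e2]
  unfold gDiff
  rw [intervalIntegral.integral_sub hI1 (hs _ _), e3, e4]
  ring

lemma lip_bound {r : ℕ} (hr : 2 ≤ r) {f : ℝ → ℝ} {ε c : ℝ} (hε : 0 < ε)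
    (hf : ContDiffOn ℝ (r : ℕ∞) f (Set.Ioo (-ε) ε))
    (hb : ∀ s ≤ r, ∀ u ∈ Set.Ioo (-ε) ε, |iteratedDerivWithin s f (Set.Ioo (-ε) ε) u| ≤ c)
    {u : ℝ} (hu : u ∈ Set.Ioo (-ε) ε) : |f u - f 0| ≤ c * |u| := by
  have h0 : (0 : ℝ) ∈ Set.Ioo (-ε) ε := ⟨by linarith, hε⟩
  have hdiff : DifferentiableOn ℝ f (Set.Ioo (-ε) ε) := hf.differentiableOn (by
    norm_cast; omega)
  have := Convex.norm_image_sub_le_of_norm_derivWithin_le (C := c) hdiff (fun x hx => by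
    have := hb 1 (by omega) x hx
    rwa [iteratedDerivWithin_one] at this) (convex_Ioo _ _) h0 hu
  simpa using this

lemma inner_bound {r : ℕ} (hr : 2 ≤ r) {G : ℝ → ℝ} (hGdiff : Differentiable ℝ G)
    (hG0 : ∀ v : ℝ, v ≤ -1 → G v = 0) (hG1 : ∀ v : ℝ, 1 ≤ v → G v = 1)
    (hG'even : ∀ v, deriv G (-v) = deriv G v) {q : ℝ} (hq : q ∈ Set.Ioo (0 : ℝ) 1)
    {M : ℝ} (hM : ∀ v, |G v| ≤ M)
    {f : ℝ → ℝ} (hfm : Measurable f) {h ε c : ℝ} (hh : 0 < h) (hhε : h ≤ ε)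
    (hf : ContDiffOn ℝ (r : ℕ∞) f (Set.Ioo (-ε) ε))
    (hb : ∀ s ≤ r, ∀ u ∈ Set.Ioo (-ε) ε, |iteratedDerivWithin s f (Set.Ioo (-ε) ε) u| ≤ c) :
    |(∫ u in Set.Ioo (-ε) ε, gDiff G q h u * f u)
      + h * (1 - ∫ u in (-1 : ℝ)..1, (G u) ^ 2) * f 0| ≤ 2 * ((M + 1) ^ 2 + 1) * h ^ 2 * c := by
  have hε : 0 < ε := by linarith
  have hfb : ∀ u ∈ Set.Ioo (-ε) ε, |f u| ≤ c := fun u hu => by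
    simpa using hb 0 (by omega) u hu
  have hc : 0 ≤ c := (abs_nonneg _).trans (hfb 0 ⟨by linarith, hε⟩)
  set K := (M + 1) ^ 2 + 1 with hK
  have hK0 : 0 ≤ K := by positivity
  have hgm := gDiff_meas hGdiff.continuous q h
  have hgb : ∀ u, |gDiff G q h u| ≤ K := gDiff_bdd hM hq h
  have hfin : volume (Set.Ioo (-ε) ε) ≠ ⊤ := by simp
  have i1 : IntegrableOn (fun u => gDiff G q h u * f u) (Set.Ioo (-ε) ε) := by
    apply Measure.integrableOn_of_bounded (M := K * c) hfin
    · exact (hgm.mul hfm).aestronglyMeasurable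
    · refine (ae_restrict_iff' measurableSet_Ioo).2 (Eventually.of_forall fun u hu => ?_)
      rw [norm_mul]
      exact mul_le_mul (hgb u) (hfb u hu) (norm_nonneg _) hK0
  have i2 : IntegrableOn (fun u => gDiff G q h u * f 0) (Set.Ioo (-ε) ε) := by
    apply Integrable.mul_const
    apply Measure.integrableOn_of_bounded (M := K) hfin
    · exact hgm.aestronglyMeasurable
    · exact Eventually.of_forall hgb
  have e : (∫ u in Set.Ioo (-ε) ε, gDiff G q h u * f u)
      + h * (1 - ∫ u in (-1 : ℝ)..1, (G u) ^ 2) * f 0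
      = ∫ u in Set.Ioo (-ε) ε, gDiff G q h u * (f u - f 0) := by
    have := integral_sub i1 i2
    simp only [mul_sub]
    rw [this, integral_mul_const, gDiff_integral hGdiff hG0 hG1 hG'even q hh hhε]
    ring
  have e1 : ∫ u in Set.Ioo (-ε) ε, gDiff G q h u * (f u - f 0)
      = ∫ u in Set.Ioo (-h) h, gDiff G q h u * (f u - f 0) := by
    apply setIntegral_eq_of_subset_of_forall_sdiff_eq_zero measurableSet_Ioo
    · exact Set.Ioo_subset_Ioo (by linarith) hhε
    · intro x hx; rw [gDiff_zero hG0 hG1 q hh hx.2, zero_mul]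
  rw [e, e1]
  have := norm_setIntegral_le_of_norm_le_const (μ := volume) (s := Set.Ioo (-h) h)
    (f := fun u => gDiff G q h u * (f u - f 0)) (C := K * (c * h)) (by simp) (fun u hu => by
      rw [norm_mul]
      refine mul_le_mul (hgb u) ?_ (norm_nonneg _) hK0
      refine (lip_bound hr hε hf hb ⟨by linarith [hu.1], by linarith [hu.2]⟩).trans ?_
      exact mul_le_mul_of_nonneg_left (abs_le.2 ⟨by linarith [hu.1], by linarith [hu.2]⟩) hc)
  rw [Real.norm_eq_abs] at this
  refine this.trans (le_of_eq ?_)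
  rw [Measure.real, Real.volume_Ioo, ENNReal.toReal_ofReal (by linarith)]
  ring

lemma cond_quantile {Ω : Type*} [MeasurableSpace Ω] (μ : Measure Ω) [IsProbabilityMeasure μ]
    {d : ℕ} {Z : Ω → Fin d → ℝ} {U : Ω → ℝ} (hZmeas : Measurable Z) (hUmeas : Measurable U)
    {q : ℝ} (hq : q ∈ Set.Ioo (0 : ℝ) 1)
    (hcq : ∀ s : Set (Fin d → ℝ), MeasurableSet s →
      μ ({ω | U ω < 0} ∩ Z ⁻¹' s) = ENNReal.ofReal q * μ (Z ⁻¹' s))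
    {ψ : (Fin d → ℝ) → ℝ} (hψ : Measurable ψ) (hi : Integrable (fun ω => ψ (Z ω)) μ) :
    ∫ ω, ((if U ω < 0 then (1 : ℝ) else 0) - q) ^ 2 * ψ (Z ω) ∂μ
      = q * (1 - q) * ∫ ω, ψ (Z ω) ∂μ := by
  have hS : MeasurableSet {ω | U ω < 0} := hUmeas measurableSet_Iio
  have hmap : Measure.map Z (μ.restrict {ω | U ω < 0}) = ENNReal.ofReal q • Measure.map Z μ := by
    ext s hs
    rw [Measure.map_apply hZmeas hs, Measure.restrict_apply (hZmeas hs), Set.inter_comm, hcq s hs,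
      Measure.smul_apply, Measure.map_apply hZmeas hs, smul_eq_mul]
  have h1 : ∫ ω in {ω | U ω < 0}, ψ (Z ω) ∂μ = q * ∫ ω, ψ (Z ω) ∂μ := by
    rw [← integral_map hZmeas.aemeasurable hψ.aestronglyMeasurable, hmap, integral_smul_measure,
      integral_map hZmeas.aemeasurable hψ.aestronglyMeasurable, ENNReal.toReal_ofReal hq.1.le,
      smul_eq_mul]
  have h2 : ∀ ω, ((if U ω < 0 then (1 : ℝ) else 0) - q) ^ 2 * ψ (Z ω)
      = q ^ 2 * ψ (Z ω) + (1 - 2 * q) * Set.indicator {ω | U ω < 0} (fun ω => ψ (Z ω)) ω := by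
    intro ω
    by_cases h : U ω < 0
    · simp [Set.indicator, h]; ring
    · simp [Set.indicator, h]
  simp only [h2]
  rw [integral_add (hi.const_mul _) ((hi.indicator hS).const_mul _), integral_const_mul,
    integral_const_mul, integral_indicator hS, h1]
  ring

lemma main_aux
    {Ω : Type*} [MeasurableSpace Ω] (μ : Measure Ω) [IsProbabilityMeasure μ]
    (d r : ℕ) (hr : 2 ≤ r)
    (Z : Ω → Fin d → ℝ) (U : Ω → ℝ) (hZmeas : Measurable Z) (hUmeas : Measurable U)
    (q : ℝ) (hq : q ∈ Set.Ioo (0 : ℝ) 1)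
    (hcq : ∀ s : Set (Fin d → ℝ), MeasurableSet s →
      μ ({ω | U ω < 0} ∩ Z ⁻¹' s) = ENNReal.ofReal q * μ (Z ⁻¹' s))
    (fUZ : (Fin d → ℝ) → ℝ → ℝ) (ε : ℝ) (hε : 0 < ε)
    (hfmeas : Measurable fun p : (Fin d → ℝ) × ℝ => fUZ p.1 p.2)
    (hdens : ∀ g : ℝ → ℝ, Measurable g → (∀ u, u ∉ Set.Ioo (-ε) ε → g u = 0) →
      (∃ Mg : ℝ, ∀ u, |g u| ≤ Mg) →
      ∀ ψ : (Fin d → ℝ) → ℝ, Measurable ψ → (∃ Mψ : ℝ, ∀ z, |ψ z| ≤ Mψ) →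
        ∫ ω, g (U ω) * ψ (Z ω) ∂μ
          = ∫ ω, (∫ u in Set.Ioo (-ε) ε, g u * fUZ (Z ω) u) * ψ (Z ω) ∂μ)
    (hfsmooth : ∀ᵐ ω ∂μ, ContDiffOn ℝ (r : ℕ∞) (fUZ (Z ω)) (Set.Ioo (-ε) ε))
    (C : (Fin d → ℝ) → ℝ)
    (hCbd : ∀ᵐ ω ∂μ, ∀ s ≤ r, ∀ u ∈ Set.Ioo (-ε) ε,
      |iteratedDerivWithin s (fUZ (Z ω)) (Set.Ioo (-ε) ε) u| ≤ C (Z ω))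
    (hCint : Integrable (fun ω => C (Z ω) * ∑ i, (Z ω i) ^ 2) μ)
    (G : ℝ → ℝ) (hGdiff : Differentiable ℝ G)
    (hG0 : ∀ v : ℝ, v ≤ -1 → G v = 0) (hG1 : ∀ v : ℝ, 1 ≤ v → G v = 1)
    (hGbdd : ∃ MG : ℝ, ∀ v, |G v| ≤ MG)
    (hG'even : ∀ v, deriv G (-v) = deriv G v)
    (φ : (Fin d → ℝ) → ℝ) (hφ : Measurable φ) (B : ℝ) (hφB : ∀ᵐ ω ∂μ, |φ (Z ω)| ≤ B)
    (hφS : ∀ z, |φ z| ≤ ∑ i, (z i) ^ 2) :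
    (fun h : ℝ =>
          (∫ ω, (G (-(U ω) / h) - q) ^ 2 * φ (Z ω) ∂μ)
            - (q * (1 - q) * (∫ ω, φ (Z ω) ∂μ)
                - h * (1 - ∫ u in (-1 : ℝ)..1, (G u) ^ 2) *
                    ∫ ω, fUZ (Z ω) 0 * φ (Z ω) ∂μ))
        =O[𝓝[>] (0 : ℝ)] (fun h => h ^ 2) := by
  obtain ⟨M, hM⟩ := hGbdd
  set K := (M + 1) ^ 2 + 1 with hK
  set A := 1 - ∫ u in (-1 : ℝ)..1, (G u) ^ 2 with hA
  -- truncated weight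
  set ψ : (Fin d → ℝ) → ℝ := fun z => max (-B) (min B (φ z)) with hψdef
  have hψm : Measurable ψ := measurable_const.max (measurable_const.min hφ)
  have hψe : ∀ᵐ ω ∂μ, φ (Z ω) = ψ (Z ω) := by
    filter_upwards [hφB] with ω hω
    have := abs_le.1 hω
    simp only [hψdef]
    rw [min_eq_right this.2, max_eq_right this.1]
  have hψb : ∃ Mψ : ℝ, ∀ z, |ψ z| ≤ Mψ := by
    refine ⟨|B|, fun z => ?_⟩
    rw [abs_le]
    refine ⟨(neg_le_neg (le_abs_self B)).trans (le_max_left _ _), max_le (neg_le_abs B) ((min_le_left _ _).trans (le_abs_self B))⟩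
  have hφi : Integrable (fun ω => φ (Z ω)) μ :=
    Integrable.of_bound (hφ.comp hZmeas).aestronglyMeasurable B hφB
  have hf0m : Measurable fun ω => fUZ (Z ω) 0 := hfmeas.comp (hZmeas.prodMk measurable_const)
  have hf0i : Integrable (fun ω => fUZ (Z ω) 0 * φ (Z ω)) μ := by
    refine hCint.mono' (hf0m.mul (hφ.comp hZmeas)).aestronglyMeasurable ?_
    filter_upwards [hCbd] with ω hω
    have h0 : |fUZ (Z ω) 0| ≤ C (Z ω) := by
      simpa using hω 0 (by omega) 0 ⟨by linarith, hε⟩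
    rw [norm_mul]
    exact mul_le_mul h0 (hφS _) (norm_nonneg _) ((abs_nonneg _).trans h0)
  refine IsBigO.of_bound (2 * K * ∫ ω, C (Z ω) * ∑ i, (Z ω i) ^ 2 ∂μ) ?_
  filter_upwards [Ioo_mem_nhdsGT hε] with h hh
  have hh0 : 0 < h := hh.1
  have hhε : h ≤ ε := hh.2.le
  set g := gDiff G q h with hg
  have hgm : Measurable g := gDiff_meas hGdiff.continuous q h
  have hgb : ∀ u, |g u| ≤ K := gDiff_bdd hM hq h
  set I : Ω → ℝ := fun ω => ∫ u in Set.Ioo (-ε) ε, g u * fUZ (Z ω) u with hI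
  have hIm : StronglyMeasurable I := by
    have h1 : StronglyMeasurable (Function.uncurry fun (z : Fin d → ℝ) (u : ℝ) => g u * fUZ z u) :=
      ((hgm.comp measurable_snd).mul hfmeas).stronglyMeasurable
    exact (h1.integral_prod_right (ν := volume.restrict (Set.Ioo (-ε) ε))).comp_measurable hZmeas
  have hbound : ∀ᵐ ω ∂μ, ‖(I ω + h * A * fUZ (Z ω) 0) * φ (Z ω)‖
      ≤ 2 * K * h ^ 2 * (C (Z ω) * ∑ i, (Z ω i) ^ 2) := by
    filter_upwards [hCbd, hfsmooth] with ω h1 h2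
    have h3 := inner_bound hr hGdiff hG0 hG1 hG'even hq hM
      (hfmeas.comp (measurable_const.prodMk measurable_id) : Measurable (fun u => fUZ (Z ω) u))
      hh0 hhε h2 h1
    rw [norm_mul, ← mul_assoc]
    exact mul_le_mul h3 (hφS _) (norm_nonneg _) ((abs_nonneg _).trans h3)
  have hsumi : Integrable (fun ω => (I ω + h * A * fUZ (Z ω) 0) * φ (Z ω)) μ := by
    refine (hCint.const_mul (2 * K * h ^ 2)).mono' ?_ hbound
    exact ((hIm.measurable.add (hf0m.const_mul _)).mul (hφ.comp hZmeas)).aestronglyMeasurable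
  have hIi : ∫ ω, I ω * φ (Z ω) ∂μ
      = (∫ ω, (I ω + h * A * fUZ (Z ω) 0) * φ (Z ω) ∂μ)
        - h * A * ∫ ω, fUZ (Z ω) 0 * φ (Z ω) ∂μ := by
    rw [← integral_const_mul, ← integral_sub hsumi (hf0i.const_mul _)]
    congr 1; ext ω; ring
  have hgI : ∫ ω, g (U ω) * φ (Z ω) ∂μ = ∫ ω, I ω * φ (Z ω) ∂μ := by
    have := hdens g hgm (fun u hu => gDiff_zero hG0 hG1 q hh0
      (fun hc => hu (Set.Ioo_subset_Ioo (by linarith) hhε hc))) ⟨K, hgb⟩ ψ hψm hψb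
    rw [integral_congr_ae (g := fun ω => g (U ω) * ψ (Z ω)) (hψe.mono fun ω hω => by simp only [hω]), this]
    exact integral_congr_ae (hψe.mono fun ω hω => by simp only [hω, hI])
  have hgi : Integrable (fun ω => g (U ω) * φ (Z ω)) μ :=
    hφi.bdd_mul (hgm.comp hUmeas).aestronglyMeasurable (Eventually.of_forall fun ω => hgb (U ω))
  have hind : Measurable fun u : ℝ => ((if u < 0 then (1 : ℝ) else 0) - q) ^ 2 :=
    ((Measurable.ite measurableSet_Iio measurable_const measurable_const).sub_const q).pow_const 2
  have hqi : Integrable (fun ω => ((if U ω < 0 then (1 : ℝ) else 0) - q) ^ 2 * φ (Z ω)) μ := by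
    refine hφi.bdd_mul (c := (1 - q) ^ 2 + q ^ 2) (hind.comp hUmeas).aestronglyMeasurable
      (Eventually.of_forall fun ω => ?_)
    rw [Real.norm_eq_abs, abs_of_nonneg (sq_nonneg _)]
    split_ifs <;> nlinarith [sq_nonneg (1-q), sq_nonneg q]
  have hsplit : ∫ ω, (G (-(U ω) / h) - q) ^ 2 * φ (Z ω) ∂μ
      = q * (1 - q) * (∫ ω, φ (Z ω) ∂μ) + ∫ ω, g (U ω) * φ (Z ω) ∂μ := by
    rw [← cond_quantile μ hZmeas hUmeas hq hcq hφ hφi, ← integral_add hqi hgi]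
    congr 1; ext ω; simp only [hg, gDiff]; ring
  have hfinal : (∫ ω, (G (-(U ω) / h) - q) ^ 2 * φ (Z ω) ∂μ)
            - (q * (1 - q) * (∫ ω, φ (Z ω) ∂μ)
                - h * A * ∫ ω, fUZ (Z ω) 0 * φ (Z ω) ∂μ)
      = ∫ ω, (I ω + h * A * fUZ (Z ω) 0) * φ (Z ω) ∂μ := by
    rw [hsplit, hgI, hIi]; ring
  rw [hfinal]
  refine (norm_integral_le_of_norm_le (hCint.const_mul (2 * K * h ^ 2)) hbound).trans (le_of_eq ?_)
  rw [integral_const_mul, Real.norm_eq_abs, abs_of_nonneg (sq_nonneg h)]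
  ring

/-- **Theorem 1 (second-moment part).** `E(W′W)` and `E(WW′)` expansions as `h → 0⁺`. -/

theorem smoothed_EE_second_moment
    {Ω : Type*} [MeasurableSpace Ω] (μ : Measure Ω) [IsProbabilityMeasure μ]
    (d r : ℕ) (hd : 0 < d) (hr : 2 ≤ r) (hreven : Even r)
    (Z : Ω → Fin d → ℝ) (U : Ω → ℝ) (hZmeas : Measurable Z) (hUmeas : Measurable U)
    (q : ℝ) (hq : q ∈ Set.Ioo (0 : ℝ) 1)
    -- Z has bounded support
    (hZbdd : ∃ c : ℝ, ∀ᵐ ω ∂μ, ∀ i, |Z ω i| ≤ c)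
    -- P(U < 0 ∣ Z) = q almost surely
    (hcq : ∀ s : Set (Fin d → ℝ), MeasurableSet s →
      μ ({ω | U ω < 0} ∩ Z ⁻¹' s) = ENNReal.ofReal q * μ (Z ⁻¹' s))
    -- fUZ is the conditional Lebesgue density of U given Z on a neighborhood (-ε, ε) of 0
    (fUZ : (Fin d → ℝ) → ℝ → ℝ) (ε : ℝ) (hε : 0 < ε)
    (hfmeas : Measurable fun p : (Fin d → ℝ) × ℝ => fUZ p.1 p.2)
    (hdens : ∀ g : ℝ → ℝ, Measurable g → (∀ u, u ∉ Set.Ioo (-ε) ε → g u = 0) →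
      (∃ Mg : ℝ, ∀ u, |g u| ≤ Mg) →
      ∀ ψ : (Fin d → ℝ) → ℝ, Measurable ψ → (∃ Mψ : ℝ, ∀ z, |ψ z| ≤ Mψ) →
        ∫ ω, g (U ω) * ψ (Z ω) ∂μ
          = ∫ ω, (∫ u in Set.Ioo (-ε) ε, g u * fUZ (Z ω) u) * ψ (Z ω) ∂μ)
    -- the conditional density is bounded away from zero near 0
    (hfpos : ∃ δ : ℝ, 0 < δ ∧ ∀ᵐ ω ∂μ, ∀ u ∈ Set.Ioo (-ε) ε, δ ≤ fUZ (Z ω) u)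
    -- and r times continuously differentiable near 0
    (hfsmooth : ∀ᵐ ω ∂μ, ContDiffOn ℝ (r : ℕ∞) (fUZ (Z ω)) (Set.Ioo (-ε) ε))
    -- with derivatives dominated by C(Z), E[C(Z)‖Z‖²] < ∞
    (C : (Fin d → ℝ) → ℝ)
    (hCbd : ∀ᵐ ω ∂μ, ∀ s ≤ r, ∀ u ∈ Set.Ioo (-ε) ε,
      |iteratedDerivWithin s (fUZ (Z ω)) (Set.Ioo (-ε) ε) u| ≤ C (Z ω))
    (hCint : Integrable (fun ω => C (Z ω) * ∑ i, (Z ω i) ^ 2) μ)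
    -- the smoothing function G
    (G : ℝ → ℝ) (hGdiff : Differentiable ℝ G)
    (hG0 : ∀ v : ℝ, v ≤ -1 → G v = 0) (hG1 : ∀ v : ℝ, 1 ≤ v → G v = 1)
    (hGbdd : ∃ MG : ℝ, ∀ v, |G v| ≤ MG)
    (hGvar : 0 < 1 - ∫ u in (-1 : ℝ)..1, (G u) ^ 2)
    -- G' is an even bounded r-th order kernel
    (hG'bdd : ∃ M' : ℝ, ∀ v, |deriv G v| ≤ M')
    (hG'even : ∀ v, deriv G (-v) = deriv G v)
    (hker0 : (∫ v in (-1 : ℝ)..1, deriv G v) = 1)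
    (hkerk : ∀ k : ℕ, 1 ≤ k → k ≤ r - 1 → (∫ v in (-1 : ℝ)..1, deriv G v * v ^ k) = 0)
    (hkerabs : IntervalIntegrable (fun v => |deriv G v * v ^ r|) volume (-1 : ℝ) 1)
    (hkerr : (∫ v in (-1 : ℝ)..1, deriv G v * v ^ r) ≠ 0) :
    ((fun h : ℝ =>
        (∫ ω, (G (-(U ω) / h) - q) ^ 2 * (∑ i, (Z ω i) ^ 2) ∂μ)
          - (q * (1 - q) * (∫ ω, ∑ i, (Z ω i) ^ 2 ∂μ)
              - h * (1 - ∫ u in (-1 : ℝ)..1, (G u) ^ 2) *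
                  ∫ ω, fUZ (Z ω) 0 * ∑ i, (Z ω i) ^ 2 ∂μ))
      =O[𝓝[>] (0 : ℝ)] (fun h => h ^ 2))
    ∧ ∀ i k : Fin d,
      (fun h : ℝ =>
          (∫ ω, (G (-(U ω) / h) - q) ^ 2 * (Z ω i * Z ω k) ∂μ)
            - (q * (1 - q) * (∫ ω, Z ω i * Z ω k ∂μ)
                - h * (1 - ∫ u in (-1 : ℝ)..1, (G u) ^ 2) *
                    ∫ ω, fUZ (Z ω) 0 * (Z ω i * Z ω k) ∂μ))
        =O[𝓝[>] (0 : ℝ)] (fun h => h ^ 2) := by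
  obtain ⟨c, hc⟩ := hZbdd
  have key := main_aux μ d r hr Z U hZmeas hUmeas q hq hcq fUZ ε hε hfmeas hdens hfsmooth C hCbd
    hCint G hGdiff hG0 hG1 hGbdd hG'even
  have hsum : ∀ᵐ ω ∂μ, ∑ i, (Z ω i) ^ 2 ≤ ∑ _i : Fin d, c ^ 2 := by
    filter_upwards [hc] with ω hω
    exact Finset.sum_le_sum fun i _ => sq_le_sq' (by linarith [(abs_le.1 (hω i)).1]) (abs_le.1 (hω i)).2
  have hnn : ∀ z : Fin d → ℝ, 0 ≤ ∑ i, (z i) ^ 2 := fun z => Finset.sum_nonneg fun i _ => sq_nonneg _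
  have hik : ∀ (i k : Fin d) (z : Fin d → ℝ), |z i * z k| ≤ ∑ j, (z j) ^ 2 := by
    intro i k z
    have hi := Finset.single_le_sum (f := fun j => (z j) ^ 2) (fun j _ => sq_nonneg _) (Finset.mem_univ i)
    have hk := Finset.single_le_sum (f := fun j => (z j) ^ 2) (fun j _ => sq_nonneg _) (Finset.mem_univ k)
    rw [abs_le]
    constructor <;> nlinarith [sq_nonneg (z i + z k), sq_nonneg (z i - z k)]
  refine ⟨?_, fun i k => ?_⟩
  · refine key (fun z => ∑ i, (z i) ^ 2) (by fun_prop) (∑ _i : Fin d, c ^ 2) ?_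
      (fun z => (abs_of_nonneg (hnn z)).le)
    · filter_upwards [hsum] with ω hω
      rwa [abs_of_nonneg (hnn _)]
  · refine key (fun z => z i * z k) (by fun_prop) (∑ _i : Fin d, c ^ 2) ?_ (hik i k)
    filter_upwards [hsum] with ω hω
    exact (hik i k _).trans hω
end

section
/- (Proposition 1) Let a = tr[E(AA′)] > 0 and b = E(B)′E(B) > 0. The function h ↦ n h^{2r} b − h a on (0,∞) has the unique minimizer h*_SEE = ( a / (b · 2nr) )^{1/(2r−1)}. Moreover, if in addition U is independent of Z with unconditional Lebesgue density f_U near 0 (so f_{U|Z}(·|z) = f_U(·)) and the first component of Z equals 1 almost surely, then h*_SEE = ( (r!)² [1 − ∫_{−1}^{1} G(u)² du] f_U(0) / ( 2r [∫_{−1}^{1} G′(v)v^r dv]² [f_U^{(r−1)}(0)]² ) · d/n )^{1/(2r−1)}. -/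
open MeasureTheory Filter Topology Asymptotics Matrix

theorem aux_min (r n : ℕ) (hr : 2 ≤ r) (hn : 1 ≤ n) (a b : ℝ) (ha : 0 < a) (hb : 0 < b)
    (s : ℝ) (hs : s = (a / (b * (2 * (n : ℝ) * r))) ^ ((1 : ℝ) / (2 * r - 1)))
    (h : ℝ) (hh : 0 < h) (hne : h ≠ s) :
    (n : ℝ) * s ^ (2 * r) * b - s * a < (n : ℝ) * h ^ (2 * r) * b - h * a := by
  have hr' : (2 : ℝ) ≤ r := by exact_mod_cast hr
  have hn' : (0 : ℝ) < n := by exact_mod_cast hn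
  have hD : 0 < b * (2 * (n : ℝ) * r) := by positivity
  have hpos : 0 < a / (b * (2 * (n : ℝ) * r)) := by positivity
  have hs0 : 0 < s := hs ▸ Real.rpow_pos_of_pos hpos _
  have hpow : s ^ (2 * r - 1) = a / (b * (2 * (n : ℝ) * r)) := by
    rw [hs, ← Real.rpow_natCast, ← Real.rpow_mul hpos.le]
    have : ((2 * r - 1 : ℕ) : ℝ) = 2 * r - 1 := by
      rw [Nat.cast_sub (by omega)]; push_cast; ring
    rw [this, one_div_mul_cancel (by linarith), Real.rpow_one]
  have ha' : a = b * (2 * (n : ℝ) * r) * s ^ (2 * r - 1) := by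
    rw [hpow]; field_simp
  have hsp : s ^ (2 * r) = s * s ^ (2 * r - 1) := by
    rw [← pow_succ']; congr 1; omega
  have hB := one_add_mul_self_lt_rpow_one_add (s := h / s - 1)
    (by have : 0 < h / s := by positivity
        linarith)
    (by intro h0; apply hne; field_simp at h0; linarith)
    (p := ((2 * r : ℕ) : ℝ)) (by push_cast; linarith)
  rw [Real.rpow_natCast, add_sub_cancel, div_pow, lt_div_iff₀ (by positivity)] at hB
  have key : (1 + ((2 * r : ℕ) : ℝ) * (h / s - 1)) * s ^ (2 * r)
      = s ^ (2 * r) + 2 * r * s ^ (2 * r - 1) * (h - s) := by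
    rw [hsp]; push_cast; field_simp
  rw [key] at hB
  have := mul_lt_mul_of_pos_left hB (mul_pos hn' hb)
  have e : s * a = 2 * r * n * b * s ^ (2 * r - 1) * s := by rw [ha']; ring
  have e2 : h * a = 2 * r * n * b * s ^ (2 * r - 1) * h := by rw [ha']; ring
  rw [e, e2]
  nlinarith

theorem aux_mom {Ω : Type*} [MeasurableSpace Ω] (μ : Measure Ω) [IsProbabilityMeasure μ]
    (d : ℕ) (hd : 0 < d) (Z : Ω → Fin d → ℝ) (hZmeas : Measurable Z) (p : ℝ) (hp : 0 < p)
    (hZbdd : ∃ c : ℝ, ∀ᵐ ω ∂μ, ∀ i, |Z ω i| ≤ c)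
    (V Vsq : Matrix (Fin d) (Fin d) ℝ)
    (hV : V = Matrix.of fun i k => p * ∫ ω, Z ω i * Z ω k ∂μ)
    (hVsq : Vsq * Vsqᵀ = V) (hVsqinv : IsUnit Vsq.det) :
    (∀ i, ∫ ω, ((Vsq⁻¹ *ᵥ Z ω) i) ^ 2 ∂μ = p⁻¹) ∧
    ((∀ᵐ ω ∂μ, Z ω ⟨0, hd⟩ = 1) → ∑ i, (∫ ω, (Vsq⁻¹ *ᵥ Z ω) i ∂μ) ^ 2 = p⁻¹) := by
  obtain ⟨c, hc⟩ := hZbdd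
  have hm : ∀ i, Measurable fun ω => Z ω i := fun i => (measurable_pi_apply i).comp hZmeas
  have hI2 : ∀ i k, Integrable (fun ω => Z ω i * Z ω k) μ := fun i k => by
    refine Integrable.of_bound ((hm i).mul (hm k)).aestronglyMeasurable (c * c) ?_
    filter_upwards [hc] with ω h
    rw [Real.norm_eq_abs, abs_mul]
    exact mul_le_mul (h i) (h k) (abs_nonneg _) ((abs_nonneg _).trans (h i))
  have hI1 : ∀ i, Integrable (fun ω => Z ω i) μ := fun i => by
    refine Integrable.of_bound (hm i).aestronglyMeasurable c ?_
    filter_upwards [hc] with ω h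
    exact h i
  have hM : ∀ i k, ∫ ω, Z ω i * Z ω k ∂μ = p⁻¹ * V i k := fun i k => by
    rw [hV]; simp only [Matrix.of_apply]; field_simp
  have hW : Vsq⁻¹ * Vsq = 1 := Matrix.nonsing_inv_mul _ hVsqinv
  have hWV : Vsq⁻¹ * V = Vsqᵀ := by rw [← hVsq, ← Matrix.mul_assoc, hW, Matrix.one_mul]
  have hWVW : Vsq⁻¹ * V * (Vsq⁻¹)ᵀ = 1 := by
    rw [hWV, ← Matrix.transpose_mul, hW, Matrix.transpose_one]
  constructor
  · intro i
    have e : ∀ ω, ((Vsq⁻¹ *ᵥ Z ω) i) ^ 2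
        = ∑ k, ∑ j, Vsq⁻¹ i j * Vsq⁻¹ i k * (Z ω j * Z ω k) := fun ω => by
      simp only [Matrix.mulVec, dotProduct]
      rw [sq, Finset.sum_mul_sum, Finset.sum_comm]
      refine Finset.sum_congr rfl fun k _ => Finset.sum_congr rfl fun j _ => by ring
    simp_rw [e]
    rw [integral_finsetSum _ fun k _ => integrable_finsetSum _ fun j _ => (hI2 j k).const_mul _]
    have h1 := congrFun (congrFun hWVW i) i
    simp only [Matrix.mul_apply, Matrix.transpose_apply, Matrix.one_apply_eq] at h1
    calc _ = p⁻¹ * ∑ k, (∑ j, Vsq⁻¹ i j * V j k) * Vsq⁻¹ i k := by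
          rw [Finset.mul_sum]
          refine Finset.sum_congr rfl fun k _ => ?_
          rw [integral_finsetSum _ fun j _ => (hI2 j k).const_mul _, Finset.sum_mul,
            Finset.mul_sum]
          refine Finset.sum_congr rfl fun j _ => ?_
          rw [integral_const_mul, hM]; ring
      _ = p⁻¹ := by rw [h1, mul_one]
  · intro hZ1
    have hE : ∀ j, ∫ ω, Z ω j ∂μ = p⁻¹ * V j ⟨0, hd⟩ := fun j => by
      rw [← hM]
      refine integral_congr_ae ?_
      filter_upwards [hZ1] with ω h
      rw [h, mul_one]
    have hV11 : p⁻¹ * V ⟨0, hd⟩ ⟨0, hd⟩ = 1 := by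
      rw [← hE]
      rw [integral_congr_ae (g := fun _ => (1 : ℝ)) hZ1]; simp
    have hEi : ∀ i, ∫ ω, (Vsq⁻¹ *ᵥ Z ω) i ∂μ = p⁻¹ * Vsq ⟨0, hd⟩ i := fun i => by
      have h1 := congrFun (congrFun hWV i) ⟨0, hd⟩
      simp only [Matrix.mul_apply, Matrix.transpose_apply] at h1
      simp only [Matrix.mulVec, dotProduct]
      rw [integral_finsetSum _ fun j _ => (hI1 j).const_mul _, ← h1, Finset.mul_sum]
      refine Finset.sum_congr rfl fun j _ => ?_
      rw [integral_const_mul, hE]; ring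
    have h2 := congrFun (congrFun hVsq ⟨0, hd⟩) ⟨0, hd⟩
    simp only [Matrix.mul_apply, Matrix.transpose_apply] at h2
    calc _ = p⁻¹ * (p⁻¹ * ∑ i, Vsq ⟨0, hd⟩ i * Vsq ⟨0, hd⟩ i) := by
          rw [Finset.mul_sum, Finset.mul_sum]
          refine Finset.sum_congr rfl fun i _ => ?_
          rw [hEi]; ring
      _ = p⁻¹ := by rw [h2, hV11, mul_one]

/-- **Proposition 1.** The bandwidth minimizing the asymptotic MSE of the SEE is
`h*_SEE = (tr[E(AA′)]/(E(B)′E(B) · 2nr))^{1/(2r−1)}`, and under `U ⟂ Z` (with common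
density `f_U`) and a constant first regressor it simplifies to
`((r!)²(1−∫G²) f_U(0) / (2r (∫G′v^r)² (f_U^{(r−1)}(0))²) · d/n)^{1/(2r−1)}`. -/
theorem optimal_SEE_bandwidth
    {Ω : Type*} [MeasurableSpace Ω] (μ : Measure Ω) [IsProbabilityMeasure μ]
    (d r : ℕ) (hd : 0 < d) (hr : 2 ≤ r) (hreven : Even r)
    (Z : Ω → Fin d → ℝ) (U : Ω → ℝ) (hZmeas : Measurable Z) (hUmeas : Measurable U)
    (q : ℝ) (hq : q ∈ Set.Ioo (0 : ℝ) 1)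
    -- Z has bounded support
    (hZbdd : ∃ c : ℝ, ∀ᵐ ω ∂μ, ∀ i, |Z ω i| ≤ c)
    -- P(U < 0 ∣ Z) = q almost surely
    (hcq : ∀ s : Set (Fin d → ℝ), MeasurableSet s →
      μ ({ω | U ω < 0} ∩ Z ⁻¹' s) = ENNReal.ofReal q * μ (Z ⁻¹' s))
    -- fUZ is the conditional Lebesgue density of U given Z on a neighborhood (-ε, ε) of 0
    (fUZ : (Fin d → ℝ) → ℝ → ℝ) (ε : ℝ) (hε : 0 < ε)
    (hfmeas : Measurable fun p : (Fin d → ℝ) × ℝ => fUZ p.1 p.2)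
    (hdens : ∀ g : ℝ → ℝ, Measurable g → (∀ u, u ∉ Set.Ioo (-ε) ε → g u = 0) →
      (∃ Mg : ℝ, ∀ u, |g u| ≤ Mg) →
      ∀ ψ : (Fin d → ℝ) → ℝ, Measurable ψ → (∃ Mψ : ℝ, ∀ z, |ψ z| ≤ Mψ) →
        ∫ ω, g (U ω) * ψ (Z ω) ∂μ
          = ∫ ω, (∫ u in Set.Ioo (-ε) ε, g u * fUZ (Z ω) u) * ψ (Z ω) ∂μ)
    -- the conditional density is bounded away from zero near 0
    (hfpos : ∃ δ : ℝ, 0 < δ ∧ ∀ᵐ ω ∂μ, ∀ u ∈ Set.Ioo (-ε) ε, δ ≤ fUZ (Z ω) u)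
    -- and r times continuously differentiable near 0
    (hfsmooth : ∀ᵐ ω ∂μ, ContDiffOn ℝ (r : ℕ∞) (fUZ (Z ω)) (Set.Ioo (-ε) ε))
    -- with derivatives dominated by C(Z), E[C(Z)‖Z‖²] < ∞
    (C : (Fin d → ℝ) → ℝ)
    (hCbd : ∀ᵐ ω ∂μ, ∀ s ≤ r, ∀ u ∈ Set.Ioo (-ε) ε,
      |iteratedDerivWithin s (fUZ (Z ω)) (Set.Ioo (-ε) ε) u| ≤ C (Z ω))
    (hCint : Integrable (fun ω => C (Z ω) * ∑ i, (Z ω i) ^ 2) μ)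
    -- the smoothing function G
    (G : ℝ → ℝ) (hGdiff : Differentiable ℝ G)
    (hG0 : ∀ v : ℝ, v ≤ -1 → G v = 0) (hG1 : ∀ v : ℝ, 1 ≤ v → G v = 1)
    (hGbdd : ∃ MG : ℝ, ∀ v, |G v| ≤ MG)
    (hGvar : 0 < 1 - ∫ u in (-1 : ℝ)..1, (G u) ^ 2)
    -- G' is an even bounded r-th order kernel
    (hG'bdd : ∃ M' : ℝ, ∀ v, |deriv G v| ≤ M')
    (hG'even : ∀ v, deriv G (-v) = deriv G v)
    (hker0 : (∫ v in (-1 : ℝ)..1, deriv G v) = 1)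
    (hkerk : ∀ k : ℕ, 1 ≤ k → k ≤ r - 1 → (∫ v in (-1 : ℝ)..1, deriv G v * v ^ k) = 0)
    (hkerabs : IntervalIntegrable (fun v => |deriv G v * v ^ r|) volume (-1 : ℝ) 1)
    (hkerr : (∫ v in (-1 : ℝ)..1, deriv G v * v ^ r) ≠ 0)
    -- E(ZZ′) nonsingular
    (hZZns : IsUnit (Matrix.of fun i k => ∫ ω, Z ω i * Z ω k ∂μ).det)
    -- V = q(1−q)E(ZZ′), a matrix square root V^{1/2}, and A, B as in the paper
    (V : Matrix (Fin d) (Fin d) ℝ)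
    (hV : V = Matrix.of fun i k => q * (1 - q) * ∫ ω, Z ω i * Z ω k ∂μ)
    (Vsq : Matrix (Fin d) (Fin d) ℝ) (hVsq : Vsq * Vsqᵀ = V) (hVsqinv : IsUnit Vsq.det)
    (A : Ω → Fin d → ℝ)
    (hA : A = fun ω => Real.sqrt (1 - ∫ u in (-1 : ℝ)..1, (G u) ^ 2) •
        Real.sqrt (fUZ (Z ω) 0) • (Vsq⁻¹ *ᵥ Z ω))
    (B : Ω → Fin d → ℝ)
    (hB : B = fun ω => (((r.factorial : ℝ))⁻¹ * ∫ v in (-1 : ℝ)..1, deriv G v * v ^ r) •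
        (iteratedDerivWithin (r - 1) (fUZ (Z ω)) (Set.Ioo (-ε) ε) 0) • (Vsq⁻¹ *ᵥ Z ω))
    -- a = tr[E(AA′)] > 0 and b = E(B)′E(B) > 0
    (a b : ℝ) (haeq : a = ∑ i, ∫ ω, (A ω i) ^ 2 ∂μ)
    (hbeq : b = ∑ i, (∫ ω, B ω i ∂μ) ^ 2)
    (ha : 0 < a) (hb : 0 < b)
    -- sample size
    (n : ℕ) (hn : 1 ≤ n) :
    let hstar : ℝ := (a / (b * (2 * (n : ℝ) * r))) ^ ((1 : ℝ) / (2 * r - 1))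
    -- h*_SEE uniquely minimizes the asymptotic MSE term n h^{2r} E(B)′E(B) − h tr[E(AA′)]
    ((∀ h ∈ Set.Ioi (0 : ℝ), h ≠ hstar →
        (n : ℝ) * hstar ^ (2 * r) * b - hstar * a < (n : ℝ) * h ^ (2 * r) * b - h * a) ∧
    -- under U ⟂ Z with common density f_U and a constant first regressor
    (∀ fU : ℝ → ℝ,
        (∀ᵐ ω ∂μ, ∀ u ∈ Set.Ioo (-ε) ε, fUZ (Z ω) u = fU u) →
        (∀ᵐ ω ∂μ, Z ω ⟨0, hd⟩ = 1) →
        hstar = ((r.factorial : ℝ) ^ 2 * (1 - ∫ u in (-1 : ℝ)..1, (G u) ^ 2) * fU 0 /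
            (2 * (r : ℝ) * (∫ v in (-1 : ℝ)..1, deriv G v * v ^ r) ^ 2 *
              (iteratedDerivWithin (r - 1) fU (Set.Ioo (-ε) ε) 0) ^ 2) *
            ((d : ℝ) / (n : ℝ))) ^ ((1 : ℝ) / (2 * r - 1)))) := by
  intro hstar
  refine ⟨fun h hh hne => aux_min r n hr hn a b ha hb hstar rfl h hh hne, ?_⟩
  intro fU hfU hZ1
  have hp : 0 < q * (1 - q) := mul_pos hq.1 (by linarith [hq.2])
  obtain ⟨m1, m2⟩ := aux_mom μ d hd Z hZmeas (q * (1 - q)) hp hZbdd V Vsq hV hVsq hVsqinv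
  have m2 := m2 hZ1
  have h0 : (0 : ℝ) ∈ Set.Ioo (-ε) ε := ⟨by linarith, hε⟩
  have hfU0 : 0 < fU 0 := by
    obtain ⟨δ, hδ, hle⟩ := hfpos
    obtain ⟨ω, h1, h2⟩ := (hle.and hfU).exists
    rw [← h2 0 h0]; exact hδ.trans_le (h1 0 h0)
  set K := 1 - ∫ u in (-1 : ℝ)..1, (G u) ^ 2 with hK
  set κ := ∫ v in (-1 : ℝ)..1, deriv G v * v ^ r with hκ
  set D := iteratedDerivWithin (r - 1) fU (Set.Ioo (-ε) ε) 0 with hDdef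
  have haval : a = K * fU 0 * d * (q * (1 - q))⁻¹ := by
    have : ∀ i, ∫ ω, (A ω i) ^ 2 ∂μ = K * fU 0 * (q * (1 - q))⁻¹ := fun i => by
      rw [← m1 i, ← integral_const_mul]
      refine integral_congr_ae ?_
      filter_upwards [hfU] with ω h
      simp only [hA, Pi.smul_apply, smul_eq_mul]
      rw [h 0 h0, mul_pow, mul_pow, Real.sq_sqrt hGvar.le, Real.sq_sqrt hfU0.le]; ring
    rw [haeq]; simp only [this, Finset.sum_const, Finset.card_univ, Fintype.card_fin, nsmul_eq_mul]
    ring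
  have hbval : b = ((r.factorial : ℝ)⁻¹ * κ * D) ^ 2 * (q * (1 - q))⁻¹ := by
    have : ∀ i, ∫ ω, B ω i ∂μ
        = ((r.factorial : ℝ)⁻¹ * κ * D) * ∫ ω, (Vsq⁻¹ *ᵥ Z ω) i ∂μ := fun i => by
      rw [← integral_const_mul]
      refine integral_congr_ae ?_
      filter_upwards [hfU] with ω h
      simp only [hB, Pi.smul_apply, smul_eq_mul]
      rw [iteratedDerivWithin_congr (show Set.EqOn (fUZ (Z ω)) fU (Set.Ioo (-ε) ε) from h) h0]
      ring
    rw [hbeq, ← m2, Finset.mul_sum]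
    refine Finset.sum_congr rfl fun i _ => ?_
    rw [this]; ring
  have hD0 : D ≠ 0 := by
    intro h; rw [h] at hbval; simp at hbval; linarith
  have hn' : (n : ℝ) ≠ 0 := by positivity
  have hr0 : (r : ℝ) ≠ 0 := by positivity
  have hfac : (r.factorial : ℝ) ≠ 0 := by positivity
  have hq0 := hp.ne'
  show (a / (b * (2 * (n : ℝ) * r))) ^ ((1 : ℝ) / (2 * r - 1)) = _
  congr 1
  rw [haval, hbval]
  generalize q * (1 - q) = p at *
  field_simp
end

section
/- (Proposition 2) Let a = tr[E(AA′)] > 0 and b = E(B)′E(B) > 0, let α ∈ (0,1), let c_α be the 1−α quantile of the chi-square distribution with d degrees of freedom, and let 𝒢′_{d+2}(c_α) be the chi-square density with d+2 degrees of freedom evaluated at c_α. Then 𝒢′_{d+2}(c_α) > 0, and the approximate type I error h ↦ α + 𝒢′_{d+2}(c_α) · ( n h^{2r} b − h a ) on (0,∞) is uniquely minimized at h*_CPE = ( a / (b · 2nr) )^{1/(2r−1)}; that is, h*_CPE = h*_SEE, the bandwidth minimizing the asymptotic MSE of the smoothed estimating equations. -/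
open MeasureTheory ProbabilityTheory

/-- The chi-square distribution with `k` degrees of freedom: the law of `‖ξ‖²` for a
standard Gaussian vector `ξ` in `ℝ^k`. -/
noncomputable def chiSqMeasure (k : ℕ) : Measure ℝ :=
  (Measure.pi fun _ : Fin k => gaussianReal 0 1).map fun x => ∑ i, (x i) ^ 2

/-- Chi-square CDF `𝒢_k`. -/
noncomputable def chiSqCDF (k : ℕ) (t : ℝ) : ℝ := (chiSqMeasure k (Set.Iic t)).toReal

/-- Chi-square Lebesgue density `𝒢′_k`. -/
noncomputable def chiSqPDF (k : ℕ) (x : ℝ) : ℝ :=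
  if 0 < x then
    x ^ ((k : ℝ) / 2 - 1) * Real.exp (-x / 2) / (2 ^ ((k : ℝ) / 2) * Real.Gamma ((k : ℝ) / 2))
  else 0

theorem chiSqCDF_nonpos (d : ℕ) (hd : 1 ≤ d) (c : ℝ) (hc : c ≤ 0) : chiSqCDF d c = 0 := by
  unfold chiSqCDF chiSqMeasure
  rw [Measure.map_apply (by fun_prop) measurableSet_Iic]
  have hsub : ((fun x : Fin d → ℝ => ∑ i, (x i) ^ 2) ⁻¹' Set.Iic c) ⊆ {0} := by
    intro x hx
    have hx' : ∑ i, (x i) ^ 2 ≤ 0 := le_trans hx hc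
    have h0 : ∑ i, (x i) ^ 2 = 0 := le_antisymm hx' (Finset.sum_nonneg fun i _ => sq_nonneg _)
    rw [Finset.sum_eq_zero_iff_of_nonneg (fun i _ => sq_nonneg _)] at h0
    ext i
    simpa using h0 i (Finset.mem_univ i)
  have hna : NullSingletonClass (gaussianReal 0 1) := nullSingletonClass_gaussianReal one_ne_zero
  have hz : (Measure.pi fun _ : Fin d => gaussianReal 0 1) {0} = 0 := by
    rw [Measure.pi_singleton]
    exact Finset.prod_eq_zero (Finset.mem_univ ⟨0, hd⟩) (measure_singleton _)
  rw [measure_mono_null hsub hz]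
  rfl

theorem tangent_lt (k : ℕ) (hk : 2 ≤ k) (x h : ℝ) (hx : 0 < x) (hh : 0 < h) (hne : h ≠ x) :
    k * x ^ (k - 1) * (h - x) < h ^ k - x ^ k := by
  have hb := one_add_mul_self_lt_rpow_one_add (s := h / x - 1) (p := k)
    (by have := div_pos hh hx; linarith)
    (by intro h0; apply hne; field_simp at h0; linarith) (by exact_mod_cast hk)
  rw [Real.rpow_natCast, add_sub_cancel, div_pow] at hb
  have hxk : 0 < x ^ k := by positivity
  rw [lt_div_iff₀ hxk] at hb
  obtain ⟨m, rfl⟩ : ∃ m, k = m + 1 := ⟨k - 1, by omega⟩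
  have e : (1 + ((m + 1 : ℕ) : ℝ) * (h / x - 1)) * x ^ (m + 1)
      = x ^ (m + 1) + ((m + 1 : ℕ) : ℝ) * x ^ m * (h - x) := by
    field_simp
    ring
  rw [e] at hb
  simp only [Nat.add_sub_cancel]
  linarith

/-- **Proposition 2.** `𝒢′_{d+2}(c_α) > 0` and the approximate type I error
`h ↦ α + 𝒢′_{d+2}(c_α)(n h^{2r} b − h a)` is uniquely minimized over `(0,∞)` at
`h*_CPE = (a/(2nrb))^{1/(2r−1)}`, which also uniquely minimizes the asymptotic MSE term
`h ↦ n h^{2r} b − h a` of the SEE, i.e. `h*_CPE = h*_SEE`. -/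
theorem type_I_error_optimal_bandwidth (a b n : ℝ) (r d : ℕ)
    (ha : 0 < a) (hb : 0 < b) (hn : 0 < n) (hr : 1 ≤ r) (hd : 1 ≤ d)
    (α : ℝ) (hα : α ∈ Set.Ioo (0 : ℝ) 1) (cα : ℝ) (hcα : chiSqCDF d cα = 1 - α) :
    let hstar : ℝ := (a / (b * (2 * n * r))) ^ ((1 : ℝ) / (2 * r - 1))
    0 < chiSqPDF (d + 2) cα ∧
    (∀ h ∈ Set.Ioi (0 : ℝ), h ≠ hstar →
      α + chiSqPDF (d + 2) cα * (n * hstar ^ (2 * r) * b - hstar * a)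
        < α + chiSqPDF (d + 2) cα * (n * h ^ (2 * r) * b - h * a)) ∧
    (∀ h ∈ Set.Ioi (0 : ℝ), h ≠ hstar →
      n * hstar ^ (2 * r) * b - hstar * a < n * h ^ (2 * r) * b - h * a) := by
  intro hstar
  have hrR : (1:ℝ) ≤ r := by exact_mod_cast hr
  have hc : 0 < cα := by
    by_contra hcon
    push Not at hcon
    have h0 : chiSqCDF d cα = 0 := chiSqCDF_nonpos d hd cα hcon
    rw [h0] at hcα
    linarith [hα.2]
  have hpdf : 0 < chiSqPDF (d + 2) cα := by
    unfold chiSqPDF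
    rw [if_pos hc]
    have : 0 < Real.Gamma (((d + 2 : ℕ) : ℝ) / 2) := Real.Gamma_pos_of_pos (by positivity)
    positivity
  have hq : 0 < a / (b * (2 * n * r)) := by positivity
  have hs : 0 < hstar := Real.rpow_pos_of_pos hq _
  have hpow : hstar ^ (2 * r - 1) = a / (b * (2 * n * r)) := by
    have hcast : ((2 * r - 1 : ℕ) : ℝ) = 2 * r - 1 := by
      rw [Nat.cast_sub (by omega)]; push_cast; ring
    rw [← Real.rpow_natCast, hcast, ← Real.rpow_mul hq.le, one_div,
      inv_mul_cancel₀ (by linarith), Real.rpow_one]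
  have ha' : a = n * b * ((2 * r : ℕ) * hstar ^ (2 * r - 1)) := by
    rw [hpow]; push_cast; field_simp
  have key : ∀ h ∈ Set.Ioi (0 : ℝ), h ≠ hstar →
      n * hstar ^ (2 * r) * b - hstar * a < n * h ^ (2 * r) * b - h * a := by
    intro h hh hne
    have ht := tangent_lt (2 * r) (by omega) hstar h hs hh hne
    have := mul_lt_mul_of_pos_left ht (mul_pos hn hb)
    generalize hstar = x at *
    rw [ha']
    linarith
  refine ⟨hpdf, fun h hh hne => ?_, key⟩
  have := mul_lt_mul_of_pos_left (key h hh hne) hpdf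
  linarith
end

section
/- (Smoothed-criterion-function EE, second moment) For exogenous quantile regression (Z_j = X_j), the estimating-equation summand obtained by smoothing the criterion function, W_j^{SCF} = X_j[G(−U_j/h) − q] − h^{−1} G′(−U_j/h) X_j U_j, satisfies E(W_j^{SCF} W_j^{SCF}′) = q(1−q) E(X_jX_j′) + h [∫_{−1}^{1} (G′(v) v)² dv] · E[ f_{U|X}(0|X_j) X_jX_j′ ] + O(h²) as h → 0⁺; in particular the O(h) term is positive, whereas the corresponding O(h) term for the smoothed estimating equations, −h[1 − ∫_{−1}^{1}G(u)²du]E[f_{U|X}(0|X_j)X_jX_j′], is negative. -/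
open MeasureTheory Filter Topology Asymptotics

lemma scf_deriv_left (G : ℝ → ℝ) (hGdiff : Differentiable ℝ G)
    (hG0 : ∀ v : ℝ, v ≤ -1 → G v = 0) (v : ℝ) (hv : v ≤ -1) : deriv G v = 0 := by
  have h1 : HasDerivWithinAt G (deriv G v) (Set.Iic v) v :=
    (hGdiff v).hasDerivAt.hasDerivWithinAt
  have h2 : HasDerivWithinAt G 0 (Set.Iic v) v := by
    refine (hasDerivWithinAt_const v (Set.Iic v) (0 : ℝ)).congr (fun x hx => ?_) (hG0 v hv)
    exact hG0 x (le_trans hx hv)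
  exact (uniqueDiffOn_Iic v v Set.self_mem_Iic).eq_deriv _ h1 h2

lemma scf_deriv_right (G : ℝ → ℝ) (hGdiff : Differentiable ℝ G)
    (hG1 : ∀ v : ℝ, 1 ≤ v → G v = 1) (v : ℝ) (hv : 1 ≤ v) : deriv G v = 0 := by
  have h1 : HasDerivWithinAt G (deriv G v) (Set.Ici v) v :=
    (hGdiff v).hasDerivAt.hasDerivWithinAt
  have h2 : HasDerivWithinAt G 0 (Set.Ici v) v := by
    refine (hasDerivWithinAt_const v (Set.Ici v) (1 : ℝ)).congr (fun x hx => ?_) (hG1 v hv)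
    exact hG1 x (le_trans hv hx)
  exact (uniqueDiffOn_Ici v v Set.self_mem_Ici).eq_deriv _ h1 h2

lemma scf_intervalIntegrable {f : ℝ → ℝ} (hf : Measurable f) {M : ℝ} (a b : ℝ)
    (hM : ∀ v ∈ Set.uIoc a b, |f v| ≤ M) : IntervalIntegrable f volume a b := by
  rw [intervalIntegrable_iff]
  refine Measure.integrableOn_of_bounded (M := M) (by simp) hf.aestronglyMeasurable ?_
  rw [ae_restrict_iff' measurableSet_uIoc]
  exact Eventually.of_forall hM

/-- The kernel difference. -/
noncomputable def scfK (G : ℝ → ℝ) (q v : ℝ) : ℝ :=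
  (G v + v * deriv G v - q) ^ 2 - ((if 0 < v then 1 else 0) - q) ^ 2

lemma scfK_meas (G : ℝ → ℝ) (hGdiff : Differentiable ℝ G) (q : ℝ) : Measurable (scfK G q) := by
  have h1 : Measurable G := hGdiff.continuous.measurable
  have h2 : Measurable (deriv G) := measurable_deriv G
  have h3 : Measurable (fun v : ℝ => if 0 < v then (1 : ℝ) else 0) :=
    Measurable.ite measurableSet_Ioi measurable_const measurable_const
  unfold scfK
  fun_prop

lemma scfK_zero (G : ℝ → ℝ) (hGdiff : Differentiable ℝ G)
    (hG0 : ∀ v : ℝ, v ≤ -1 → G v = 0) (hG1 : ∀ v : ℝ, 1 ≤ v → G v = 1) (q v : ℝ)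
    (hv : 1 ≤ |v|) : scfK G q v = 0 := by
  unfold scfK
  rcases le_abs.1 hv with h | h
  · rw [scf_deriv_right G hGdiff hG1 v h, hG1 v h, if_pos (by linarith)]; ring
  · rw [scf_deriv_left G hGdiff hG0 v (by linarith), hG0 v (by linarith), if_neg (by linarith)]
    ring

lemma scfK_bdd (G : ℝ → ℝ) (hGdiff : Differentiable ℝ G)
    (hG0 : ∀ v : ℝ, v ≤ -1 → G v = 0) (hG1 : ∀ v : ℝ, 1 ≤ v → G v = 1)
    (hGbdd : ∃ MG : ℝ, ∀ v, |G v| ≤ MG) (hG'bdd : ∃ M' : ℝ, ∀ v, |deriv G v| ≤ M') (q : ℝ) :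
    ∃ K : ℝ, 0 ≤ K ∧ ∀ v, |scfK G q v| ≤ K := by
  obtain ⟨A, hA⟩ := hGbdd
  obtain ⟨B, hB⟩ := hG'bdd
  have hA0 : 0 ≤ A := (abs_nonneg _).trans (hA 0)
  have hB0 : 0 ≤ B := (abs_nonneg _).trans (hB 0)
  refine ⟨(A + B + |q|) ^ 2 + (1 + |q|) ^ 2, by positivity, fun v => ?_⟩
  by_cases hv : 1 ≤ |v|
  · rw [scfK_zero G hGdiff hG0 hG1 q v hv, abs_zero]; positivity
  · push Not at hv
    have h1 : |G v + v * deriv G v - q| ≤ A + B + |q| := by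
      have h3 : |v * deriv G v| ≤ B := by
        rw [abs_mul]
        calc |v| * |deriv G v| ≤ 1 * B := by
              apply mul_le_mul hv.le (hB v) (abs_nonneg _) zero_le_one
          _ = B := one_mul B
      calc |G v + v * deriv G v - q| ≤ |G v + v * deriv G v| + |q| := abs_sub _ _
        _ ≤ |G v| + |v * deriv G v| + |q| := by gcongr; exact abs_add_le _ _
        _ ≤ _ := by gcongr; exact hA v
    have h2 : |(if 0 < v then (1 : ℝ) else 0) - q| ≤ 1 + |q| := by
      refine (abs_sub _ _).trans ?_
      gcongr
      split_ifs <;> simp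
    unfold scfK
    refine (abs_sub _ _).trans ?_
    rw [abs_pow, abs_pow]
    gcongr

lemma scfK_integral (G : ℝ → ℝ) (hGdiff : Differentiable ℝ G)
    (hG0 : ∀ v : ℝ, v ≤ -1 → G v = 0) (hG1 : ∀ v : ℝ, 1 ≤ v → G v = 1)
    (hGbdd : ∃ MG : ℝ, ∀ v, |G v| ≤ MG) (hG'bdd : ∃ M' : ℝ, ∀ v, |deriv G v| ≤ M') (q : ℝ) :
    ∫ v, scfK G q v = ∫ v in (-1 : ℝ)..1, (deriv G v * v) ^ 2 := by
  obtain ⟨B, hB⟩ := hG'bdd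
  have hB0 : 0 ≤ B := (abs_nonneg _).trans (hB 0)
  have hGm : Continuous G := hGdiff.continuous
  have hDm : Measurable (deriv G) := measurable_deriv G
  have hD : IntervalIntegrable (deriv G) volume (-1) 1 :=
    scf_intervalIntegrable hDm (M := B) _ _ fun v _ => hB v
  have hQ : IntervalIntegrable (fun v => (deriv G v * v) ^ 2) volume (-1) 1 := by
    refine scf_intervalIntegrable (by fun_prop) (M := (B * 1) ^ 2) _ _ fun v hv => ?_
    rw [Set.uIoc_of_le (by norm_num)] at hv
    rw [abs_pow, abs_mul]
    have : |v| ≤ 1 := abs_le.2 ⟨hv.1.le, hv.2⟩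
    gcongr
    exact hB v
  have hS : ∀ v, HasDerivAt (fun v => v * (G v) ^ 2 - 2 * q * (v * G v) + q ^ 2 * v)
      ((G v) ^ 2 + 2 * v * G v * deriv G v - 2 * q * (G v + v * deriv G v) + q ^ 2) v := by
    intro v
    have hG := (hGdiff v).hasDerivAt
    have h1 := (hasDerivAt_id v).mul (hG.pow 2)
    have h2 := ((hasDerivAt_id v).mul hG).const_mul (2 * q)
    have h3 := (hasDerivAt_id v).const_mul (q ^ 2)
    refine ((h1.sub h2).add h3).congr_deriv ?_
    simp
    ring
  have hSi : IntervalIntegrable (fun v => (G v) ^ 2 + 2 * v * G v * deriv G v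
      - 2 * q * (G v + v * deriv G v) + q ^ 2) volume (-1) 1 := by
    have e : (fun v => (G v) ^ 2 + 2 * v * G v * deriv G v
      - 2 * q * (G v + v * deriv G v) + q ^ 2) = fun v =>
        ((G v) ^ 2 - 2 * q * G v + q ^ 2) + (2 * v * G v - 2 * q * v) * deriv G v := by
      funext v; ring
    rw [e]
    refine IntervalIntegrable.add (Continuous.intervalIntegrable (by fun_prop) _ _) ?_
    exact hD.continuousOn_mul (Continuous.continuousOn (by fun_prop))
  have hSint := intervalIntegral.integral_eq_sub_of_hasDerivAt (fun v _ => hS v) hSi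
  rw [hG1 1 le_rfl, hG0 (-1) le_rfl] at hSint
  have hIm : Measurable (fun v : ℝ => ((if 0 < v then (1 : ℝ) else 0) - q) ^ 2) :=
    ((Measurable.ite measurableSet_Ioi measurable_const measurable_const).sub_const q).pow_const 2
  have hIi : ∀ a b : ℝ, IntervalIntegrable
      (fun v : ℝ => ((if 0 < v then (1 : ℝ) else 0) - q) ^ 2) volume a b := by
    intro a b
    refine scf_intervalIntegrable hIm (M := (1 + |q|) ^ 2) _ _ fun v _ => ?_
    rw [abs_pow]
    gcongr
    refine (abs_sub _ _).trans ?_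
    gcongr
    split_ifs <;> simp
  have hI : ∫ v in (-1 : ℝ)..1, ((if 0 < v then (1 : ℝ) else 0) - q) ^ 2
      = (1 - q) ^ 2 + q ^ 2 := by
    rw [← intervalIntegral.integral_add_adjacent_intervals (hIi (-1) 0) (hIi 0 1)]
    have e1 : ∫ v in (-1 : ℝ)..0, ((if 0 < v then (1 : ℝ) else 0) - q) ^ 2 = q ^ 2 := by
      rw [intervalIntegral.integral_congr (g := fun _ => q ^ 2)]
      · simp
      · intro v hv
        rw [Set.uIcc_of_le (by norm_num)] at hv
        simp [not_lt.2 hv.2]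
    have e2 : ∫ v in (0 : ℝ)..1, ((if 0 < v then (1 : ℝ) else 0) - q) ^ 2 = (1 - q) ^ 2 := by
      rw [intervalIntegral.integral_congr_ae (g := fun _ => (1 - q) ^ 2)]
      · simp
      · refine Eventually.of_forall fun v hv => ?_
        rw [Set.uIoc_of_le (by norm_num)] at hv
        simp [hv.1]
    rw [e1, e2]; ring
  have hK : ∫ v, scfK G q v = ∫ v in (-1 : ℝ)..1, scfK G q v := by
    rw [intervalIntegral.integral_of_le (by norm_num)]
    symm
    apply setIntegral_eq_integral_of_forall_compl_eq_zero
    intro v hv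
    apply scfK_zero G hGdiff hG0 hG1
    by_contra hc
    push Not at hc
    rw [abs_lt] at hc
    exact hv ⟨hc.1, hc.2.le⟩
  rw [hK]
  have e : ∀ v, scfK G q v = (((G v) ^ 2 + 2 * v * G v * deriv G v
      - 2 * q * (G v + v * deriv G v) + q ^ 2) + (deriv G v * v) ^ 2)
      - ((if 0 < v then (1 : ℝ) else 0) - q) ^ 2 := by
    intro v; unfold scfK; ring
  simp_rw [e]
  rw [intervalIntegral.integral_sub (hSi.add hQ) (hIi _ _),
    intervalIntegral.integral_add hSi hQ, hSint, hI]
  ring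

lemma scf_pos (G : ℝ → ℝ) (r : ℕ) (hr : 2 ≤ r) (hG'bdd : ∃ M' : ℝ, ∀ v, |deriv G v| ≤ M')
    (hkerr : (∫ v in (-1 : ℝ)..1, deriv G v * v ^ r) ≠ 0) :
    0 < ∫ v in (-1 : ℝ)..1, (deriv G v * v) ^ 2 := by
  obtain ⟨B, hB⟩ := hG'bdd
  have hDm : Measurable (deriv G) := measurable_deriv G
  have hQ : IntervalIntegrable (fun v => (deriv G v * v) ^ 2) volume (-1) 1 := by
    refine scf_intervalIntegrable (by fun_prop) (M := (B * 1) ^ 2) _ _ fun v hv => ?_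
    rw [Set.uIoc_of_le (by norm_num)] at hv
    rw [abs_pow, abs_mul]
    have : |v| ≤ 1 := abs_le.2 ⟨hv.1.le, hv.2⟩
    have hB0 : 0 ≤ B := (abs_nonneg _).trans (hB 0)
    gcongr
    exact hB v
  have h0 : 0 ≤ ∫ v in (-1 : ℝ)..1, (deriv G v * v) ^ 2 :=
    intervalIntegral.integral_nonneg (by norm_num) fun v _ => sq_nonneg _
  refine lt_of_le_of_ne h0 fun h => hkerr ?_
  rw [intervalIntegral.integral_of_le (by norm_num)] at h ⊢
  have h1 := (integral_eq_zero_iff_of_nonneg (fun v => sq_nonneg (deriv G v * v))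
    ((intervalIntegrable_iff_integrableOn_Ioc_of_le (by norm_num)).1 hQ)).1 h.symm
  apply integral_eq_zero_of_ae
  filter_upwards [h1] with v hv
  have hv' : deriv G v * v = 0 := by simpa using hv
  obtain ⟨m, rfl⟩ : ∃ m, r = m + 1 := ⟨r - 1, by omega⟩
  simp only [Pi.zero_apply]
  rw [pow_succ, mul_comm (v ^ m), ← mul_assoc, hv', zero_mul]

/-- inner estimate -/
lemma scf_inner (k f : ℝ → ℝ) (ε h K Cx : ℝ) (hh : 0 < h) (hhε : h < ε) (hk : Measurable k)
    (hf : Measurable f)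
    (hk0 : ∀ v, 1 ≤ |v| → k v = 0) (hK0 : 0 ≤ K) (hK : ∀ v, |k v| ≤ K)
    (hfd : DifferentiableOn ℝ f (Set.Ioo (-ε) ε))
    (hf0 : ∀ u ∈ Set.Ioo (-ε) ε, |f u| ≤ Cx)
    (hf1 : ∀ u ∈ Set.Ioo (-ε) ε, |derivWithin f (Set.Ioo (-ε) ε) u| ≤ Cx) :
    |(∫ u in Set.Ioo (-ε) ε, k (-u / h) * f u) - h * (∫ v, k v) * f 0| ≤ 2 * K * h ^ 2 * Cx := by
  have hε : 0 < ε := hh.trans hhε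
  have h0mem : (0 : ℝ) ∈ Set.Ioo (-ε) ε := ⟨by linarith, hε⟩
  have hCx : 0 ≤ Cx := (abs_nonneg _).trans (hf0 0 h0mem)
  have hkz : ∀ u, h ≤ |u| → k (-u / h) = 0 := by
    intro u hu
    apply hk0
    rw [abs_div, abs_neg, abs_of_pos hh, le_div_iff₀ hh]; linarith
  have hkm : Measurable fun u => k (-u / h) := hk.comp (by fun_prop)
  have hi : h * (∫ v, k v) = ∫ u in Set.Ioo (-ε) ε, k (-u / h) := by
    rw [setIntegral_eq_integral_of_forall_compl_eq_zero]
    · have e1 : ∫ u, k (-u / h) = ∫ u, k (u / h) := by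
        rw [← integral_neg_eq_self (fun u => k (u / h))]
      rw [e1, Measure.integral_comp_div, abs_of_pos hh, smul_eq_mul]
    · intro u hu
      apply hkz
      by_contra hc
      push Not at hc
      rw [abs_lt] at hc
      exact hu ⟨by linarith, by linarith⟩
  have hint1 : IntegrableOn (fun u => k (-u / h) * f u) (Set.Ioo (-ε) ε) := by
    refine Measure.integrableOn_of_bounded (M := K * Cx) (by simp)
      (hkm.mul hf).aestronglyMeasurable ?_
    rw [ae_restrict_iff' measurableSet_Ioo]
    refine Eventually.of_forall fun u hu => ?_
    rw [Real.norm_eq_abs, abs_mul]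
    exact mul_le_mul (hK _) (hf0 u hu) (abs_nonneg _) hK0
  have hint2 : IntegrableOn (fun u => k (-u / h)) (Set.Ioo (-ε) ε) := by
    refine Measure.integrableOn_of_bounded (M := K) (by simp) hkm.aestronglyMeasurable ?_
    exact Eventually.of_forall fun u => hK _
  rw [hi, ← integral_mul_const, ← integral_sub hint1 (hint2.mul_const _)]
  have e2 : ∫ u in Set.Ioo (-ε) ε, (k (-u / h) * f u - k (-u / h) * f 0)
      = ∫ u in Set.Icc (-h) h, (k (-u / h) * f u - k (-u / h) * f 0) := by
    apply setIntegral_eq_of_subset_of_forall_sdiff_eq_zero measurableSet_Ioo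
    · intro u hu; exact ⟨by linarith [hu.1], by linarith [hu.2]⟩
    · intro u hu
      rw [hkz u]
      · ring
      · by_contra hc
        push Not at hc
        rw [abs_lt] at hc
        exact hu.2 ⟨hc.1.le, hc.2.le⟩
  rw [e2, ← Real.norm_eq_abs]
  have hb := norm_setIntegral_le_of_norm_le_const (μ := volume) (s := Set.Icc (-h) h)
    (f := fun u => k (-u / h) * f u - k (-u / h) * f 0) (C := K * (Cx * h)) (by simp) (by
      intro u hu
      have hu' : u ∈ Set.Ioo (-ε) ε := ⟨by linarith [hu.1], by linarith [hu.2]⟩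
      have hl := (convex_Ioo (-ε) ε).norm_image_sub_le_of_norm_derivWithin_le hfd hf1 h0mem hu'
      rw [← mul_sub, norm_mul]
      refine mul_le_mul (hK _) (hl.trans ?_) (norm_nonneg _) hK0
      rw [sub_zero]
      gcongr
      exact abs_le.2 hu)
  refine hb.trans (le_of_eq ?_)
  rw [Real.volume_real_Icc_of_le (by linarith)]
  ring

/-- **SCF estimating equations, second moment** (comparison with SEE). -/
theorem SCF_EE_second_moment
    {Ω : Type*} [MeasurableSpace Ω] (μ : Measure Ω) [IsProbabilityMeasure μ]
    (d r : ℕ) (hd : 0 < d) (hr : 2 ≤ r) (hreven : Even r)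
    (X : Ω → Fin d → ℝ) (U : Ω → ℝ) (hXmeas : Measurable X) (hUmeas : Measurable U)
    (q : ℝ) (hq : q ∈ Set.Ioo (0 : ℝ) 1)
    -- Z has bounded support
    (hXbdd : ∃ c : ℝ, ∀ᵐ ω ∂μ, ∀ i, |X ω i| ≤ c)
    -- P(U < 0 ∣ Z) = q almost surely
    (hcq : ∀ s : Set (Fin d → ℝ), MeasurableSet s →
      μ ({ω | U ω < 0} ∩ X ⁻¹' s) = ENNReal.ofReal q * μ (X ⁻¹' s))
    -- fUX is the conditional Lebesgue density of U given Z on a neighborhood (-ε, ε) of 0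
    (fUX : (Fin d → ℝ) → ℝ → ℝ) (ε : ℝ) (hε : 0 < ε)
    (hfmeas : Measurable fun p : (Fin d → ℝ) × ℝ => fUX p.1 p.2)
    (hdens : ∀ g : ℝ → ℝ, Measurable g → (∀ u, u ∉ Set.Ioo (-ε) ε → g u = 0) →
      (∃ Mg : ℝ, ∀ u, |g u| ≤ Mg) →
      ∀ ψ : (Fin d → ℝ) → ℝ, Measurable ψ → (∃ Mψ : ℝ, ∀ z, |ψ z| ≤ Mψ) →
        ∫ ω, g (U ω) * ψ (X ω) ∂μ
          = ∫ ω, (∫ u in Set.Ioo (-ε) ε, g u * fUX (X ω) u) * ψ (X ω) ∂μ)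
    -- the conditional density is bounded away from zero near 0
    (hfpos : ∃ δ : ℝ, 0 < δ ∧ ∀ᵐ ω ∂μ, ∀ u ∈ Set.Ioo (-ε) ε, δ ≤ fUX (X ω) u)
    -- and r times continuously differentiable near 0
    (hfsmooth : ∀ᵐ ω ∂μ, ContDiffOn ℝ (r : ℕ∞) (fUX (X ω)) (Set.Ioo (-ε) ε))
    -- with derivatives dominated by C(Z), E[C(Z)‖Z‖²] < ∞
    (C : (Fin d → ℝ) → ℝ)
    (hCbd : ∀ᵐ ω ∂μ, ∀ s ≤ r, ∀ u ∈ Set.Ioo (-ε) ε,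
      |iteratedDerivWithin s (fUX (X ω)) (Set.Ioo (-ε) ε) u| ≤ C (X ω))
    (hCint : Integrable (fun ω => C (X ω) * ∑ i, (X ω i) ^ 2) μ)
    -- the smoothing function G
    (G : ℝ → ℝ) (hGdiff : Differentiable ℝ G)
    (hG0 : ∀ v : ℝ, v ≤ -1 → G v = 0) (hG1 : ∀ v : ℝ, 1 ≤ v → G v = 1)
    (hGbdd : ∃ MG : ℝ, ∀ v, |G v| ≤ MG)
    (hGvar : 0 < 1 - ∫ u in (-1 : ℝ)..1, (G u) ^ 2)
    -- G' is an even bounded r-th order kernel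
    (hG'bdd : ∃ M' : ℝ, ∀ v, |deriv G v| ≤ M')
    (hG'even : ∀ v, deriv G (-v) = deriv G v)
    (hker0 : (∫ v in (-1 : ℝ)..1, deriv G v) = 1)
    (hkerk : ∀ k : ℕ, 1 ≤ k → k ≤ r - 1 → (∫ v in (-1 : ℝ)..1, deriv G v * v ^ k) = 0)
    (hkerabs : IntervalIntegrable (fun v => |deriv G v * v ^ r|) volume (-1 : ℝ) 1)
    (hkerr : (∫ v in (-1 : ℝ)..1, deriv G v * v ^ r) ≠ 0) :
    (∀ i k : Fin d,
      (fun h : ℝ =>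
          (∫ ω, ((G (-(U ω) / h) - q) * X ω i - h⁻¹ * deriv G (-(U ω) / h) * X ω i * U ω) *
                 ((G (-(U ω) / h) - q) * X ω k - h⁻¹ * deriv G (-(U ω) / h) * X ω k * U ω) ∂μ)
            - (q * (1 - q) * (∫ ω, X ω i * X ω k ∂μ)
                + h * (∫ v in (-1 : ℝ)..1, (deriv G v * v) ^ 2) *
                    ∫ ω, fUX (X ω) 0 * (X ω i * X ω k) ∂μ))
        =O[𝓝[>] (0 : ℝ)] (fun h => h ^ 2))
    -- the O(h) coefficient of the SCF second moment is positive
    ∧ (0 < ∫ v in (-1 : ℝ)..1, (deriv G v * v) ^ 2)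
    -- while the matrix E[f_{U|X}(0|X) X X′] is positive semidefinite, so the
    -- corresponding SEE O(h) term −h[1 − ∫G²]E[f_{U|X}(0|X)XX′] is negative semidefinite
    ∧ (∀ c : Fin d → ℝ,
        0 ≤ ∑ i, ∑ k, c i * (∫ ω, fUX (X ω) 0 * (X ω i * X ω k) ∂μ) * c k) := by
  obtain ⟨c₀, hc₀⟩ := hXbdd
  obtain ⟨δ, hδ, hfδ⟩ := hfpos
  have h0mem : (0 : ℝ) ∈ Set.Ioo (-ε) ε := ⟨by linarith, hε⟩
  have hXi : ∀ i, Measurable fun ω => X ω i := fun i => (measurable_pi_apply i).comp hXmeas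
  have hf0m : Measurable fun ω => fUX (X ω) 0 :=
    hfmeas.comp (hXmeas.prodMk measurable_const)
  have hCf : ∀ᵐ ω ∂μ, ∀ u ∈ Set.Ioo (-ε) ε, |fUX (X ω) u| ≤ C (X ω) := by
    filter_upwards [hCbd] with ω hω u hu
    simpa using hω 0 (by omega) u hu
  have hXX : ∀ ω, ∀ i k : Fin d, |X ω i * X ω k| ≤ ∑ j, (X ω j) ^ 2 := by
    intro ω i k
    have h1 : (X ω i) ^ 2 ≤ ∑ j, (X ω j) ^ 2 :=
      Finset.single_le_sum (f := fun j => (X ω j) ^ 2) (fun j _ => sq_nonneg _) (Finset.mem_univ i)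
    have h2 : (X ω k) ^ 2 ≤ ∑ j, (X ω j) ^ 2 :=
      Finset.single_le_sum (f := fun j => (X ω j) ^ 2) (fun j _ => sq_nonneg _) (Finset.mem_univ k)
    rw [abs_mul]
    nlinarith [sq_nonneg (|X ω i| - |X ω k|), sq_abs (X ω i), sq_abs (X ω k)]
  have hfint : ∀ i k : Fin d, Integrable (fun ω => fUX (X ω) 0 * (X ω i * X ω k)) μ := by
    intro i k
    refine hCint.mono' (hf0m.mul ((hXi i).mul (hXi k))).aestronglyMeasurable ?_
    filter_upwards [hCf] with ω hω
    rw [Real.norm_eq_abs, abs_mul]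
    have := hω 0 h0mem
    exact mul_le_mul this (hXX ω i k) (abs_nonneg _) ((abs_nonneg _).trans this)
  refine ⟨?_, scf_pos G r hr hG'bdd hkerr, ?_⟩
  · intro i k
    obtain ⟨K, hK0, hK⟩ := scfK_bdd G hGdiff hG0 hG1 hGbdd hG'bdd q
    have hκ := scfK_integral G hGdiff hG0 hG1 hGbdd hG'bdd q
    have hkm := scfK_meas G hGdiff q
    have hkz := scfK_zero G hGdiff hG0 hG1 q
    have hXXint : Integrable (fun ω => X ω i * X ω k) μ := by
      refine Integrable.of_bound ((hXi i).mul (hXi k)).aestronglyMeasurable (c₀ * c₀) ?_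
      filter_upwards [hc₀] with ω hω
      rw [Real.norm_eq_abs, abs_mul]
      exact mul_le_mul (hω i) (hω k) (abs_nonneg _) ((abs_nonneg _).trans (hω i))
    have hUm : MeasurableSet {ω | U ω < 0} := measurableSet_lt hUmeas measurable_const
    -- the non-smoothed second moment
    have hmap : Measure.map X (μ.restrict {ω | U ω < 0}) = ENNReal.ofReal q • Measure.map X μ := by
      ext s hs
      rw [Measure.map_apply hXmeas hs, Measure.restrict_apply (hXmeas hs), Measure.smul_apply,
        Measure.map_apply hXmeas hs, smul_eq_mul, ← hcq s hs, Set.inter_comm]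
    have hφm : Measurable fun z : Fin d → ℝ => z i * z k :=
      (measurable_pi_apply i).mul (measurable_pi_apply k)
    have hIq : ∫ ω in {ω | U ω < 0}, X ω i * X ω k ∂μ = q * ∫ ω, X ω i * X ω k ∂μ := by
      have h1 := integral_map (μ := μ.restrict {ω | U ω < 0}) hXmeas.aemeasurable
        (f := fun z : Fin d → ℝ => z i * z k) hφm.aestronglyMeasurable
      have h2 := integral_map (μ := μ) hXmeas.aemeasurable
        (f := fun z : Fin d → ℝ => z i * z k) hφm.aestronglyMeasurable
      rw [hmap, integral_smul_measure, h2, ENNReal.toReal_ofReal hq.1.le] at h1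
      exact h1.symm
    have hJm : Measurable fun ω => ((if U ω < 0 then (1 : ℝ) else 0) - q) ^ 2 :=
      ((Measurable.ite hUm measurable_const measurable_const).sub_const q).pow_const 2
    have hJeq : ∀ ω, ((if U ω < 0 then (1 : ℝ) else 0) - q) ^ 2 * (X ω i * X ω k)
        = (1 - 2 * q) * ({ω | U ω < 0}.indicator (fun ω => X ω i * X ω k) ω)
          + q ^ 2 * (X ω i * X ω k) := by
      intro ω
      by_cases hU : U ω < 0
      · rw [if_pos hU, Set.indicator_of_mem (by exact hU)]; ring
      · rw [if_neg hU, Set.indicator_of_notMem (by exact hU)]; ring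
    have hJint : Integrable (fun ω => ((if U ω < 0 then (1 : ℝ) else 0) - q) ^ 2
        * (X ω i * X ω k)) μ := by
      simp_rw [hJeq]
      exact ((hXXint.indicator hUm).const_mul _).add (hXXint.const_mul _)
    have hJ : ∫ ω, ((if U ω < 0 then (1 : ℝ) else 0) - q) ^ 2 * (X ω i * X ω k) ∂μ
        = q * (1 - q) * ∫ ω, X ω i * X ω k ∂μ := by
      simp_rw [hJeq]
      rw [integral_add ((hXXint.indicator hUm).const_mul _) (hXXint.const_mul _),
        integral_const_mul, integral_const_mul, integral_indicator hUm, hIq]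
      ring
    -- a bounded version of the weight
    let ψ : (Fin d → ℝ) → ℝ := fun z => max (-(c₀ * c₀)) (min (c₀ * c₀) (z i * z k))
    have hψm : Measurable ψ := measurable_const.max (measurable_const.min hφm)
    have hψb : ∃ Mψ : ℝ, ∀ z, |ψ z| ≤ Mψ := by
      refine ⟨c₀ * c₀, fun z => abs_le.2 ⟨le_max_left _ _, max_le ?_ (min_le_left _ _)⟩⟩
      nlinarith [mul_self_nonneg c₀]
    have hψX : ∀ᵐ ω ∂μ, ψ (X ω) = X ω i * X ω k := by
      filter_upwards [hc₀] with ω hω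
      have hb : |X ω i * X ω k| ≤ c₀ * c₀ := by
        rw [abs_mul]
        exact mul_le_mul (hω i) (hω k) (abs_nonneg _) ((abs_nonneg _).trans (hω i))
      rw [abs_le] at hb
      simp only [ψ]
      rw [min_eq_right hb.2, max_eq_right hb.1]
    set B : ℝ := ∫ ω, C (X ω) * ∑ i, (X ω i) ^ 2 ∂μ with hB
    refine IsBigO.of_bound (2 * K * B) ?_
    have hmem : Set.Ioo (0 : ℝ) ε ∈ 𝓝[>] (0 : ℝ) := Ioo_mem_nhdsGT hε
    filter_upwards [hmem] with h hh
    obtain ⟨hh0, hhε⟩ := hh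
    have hgm : Measurable fun u : ℝ => scfK G q (-u / h) := hkm.comp (by fun_prop)
    have hsplit : ∀ ω,
        ((G (-(U ω) / h) - q) * X ω i - h⁻¹ * deriv G (-(U ω) / h) * X ω i * U ω) *
          ((G (-(U ω) / h) - q) * X ω k - h⁻¹ * deriv G (-(U ω) / h) * X ω k * U ω)
        = scfK G q (-(U ω) / h) * (X ω i * X ω k)
          + ((if U ω < 0 then (1 : ℝ) else 0) - q) ^ 2 * (X ω i * X ω k) := by
      intro ω
      have hiff : (0 < -(U ω) / h) ↔ U ω < 0 := by
        rw [lt_div_iff₀ hh0, zero_mul, neg_pos]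
      unfold scfK
      simp only [hiff]
      rw [div_eq_mul_inv]
      ring
    have hgint : Integrable (fun ω => scfK G q (-(U ω) / h) * (X ω i * X ω k)) μ :=
      hXXint.bdd_mul (c := K) (hgm.comp hUmeas).aestronglyMeasurable
        (Eventually.of_forall fun ω => hK _)
    have hd1 := hdens (fun u => scfK G q (-u / h)) hgm (by
      intro u hu
      apply hkz
      rw [abs_div, abs_neg, abs_of_pos hh0, le_div_iff₀ hh0, one_mul]
      by_contra hc
      push Not at hc
      rw [abs_lt] at hc
      exact hu ⟨by linarith, by linarith⟩) ⟨K, fun u => hK _⟩ ψ hψm hψb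
    have hd2 : ∫ ω, scfK G q (-(U ω) / h) * (X ω i * X ω k) ∂μ
        = ∫ ω, (∫ u in Set.Ioo (-ε) ε, scfK G q (-u / h) * fUX (X ω) u) * (X ω i * X ω k) ∂μ := by
      have e1 : ∫ ω, scfK G q (-(U ω) / h) * (X ω i * X ω k) ∂μ
          = ∫ ω, scfK G q (-(U ω) / h) * ψ (X ω) ∂μ := by
        apply integral_congr_ae
        filter_upwards [hψX] with ω hω
        rw [hω]
      rw [e1, hd1]
      apply integral_congr_ae
      filter_upwards [hψX] with ω hω
      rw [hω]
    have hest : ∀ᵐ ω ∂μ, |(∫ u in Set.Ioo (-ε) ε, scfK G q (-u / h) * fUX (X ω) u)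
        - h * (∫ v, scfK G q v) * fUX (X ω) 0| ≤ 2 * K * h ^ 2 * C (X ω) := by
      filter_upwards [hCf, hCbd, hfsmooth] with ω h1 h2 h3
      refine scf_inner (scfK G q) (fUX (X ω)) ε h K (C (X ω)) hh0 hhε hkm ?_ hkz hK0 hK ?_ h1 ?_
      · exact hfmeas.comp (measurable_const.prodMk measurable_id)
      · refine h3.differentiableOn ?_
        exact_mod_cast (by omega : r ≠ 0)
      · intro u hu
        have := h2 1 (by omega) u hu
        rwa [iteratedDerivWithin_one] at this
    have hest2 : ∀ᵐ ω ∂μ,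
        ‖(∫ u in Set.Ioo (-ε) ε, scfK G q (-u / h) * fUX (X ω) u) * (X ω i * X ω k)
        - h * (∫ v, scfK G q v) * (fUX (X ω) 0 * (X ω i * X ω k))‖
          ≤ 2 * K * h ^ 2 * (C (X ω) * ∑ j, (X ω j) ^ 2) := by
      filter_upwards [hest] with ω hω
      rw [← mul_assoc (h * _) (fUX (X ω) 0), ← sub_mul, norm_mul, ← mul_assoc (2 * K * h ^ 2)]
      exact mul_le_mul hω (hXX ω i k) (abs_nonneg _) ((abs_nonneg _).trans hω)
    have hFm : Measurable fun ω =>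
        (∫ u in Set.Ioo (-ε) ε, scfK G q (-u / h) * fUX (X ω) u) * (X ω i * X ω k) := by
      refine Measurable.mul ?_ ((hXi i).mul (hXi k))
      have hm : Measurable fun p : (Fin d → ℝ) × ℝ => scfK G q (-p.2 / h) * fUX p.1 p.2 :=
        (hgm.comp measurable_snd).mul hfmeas
      have := (hm.stronglyMeasurable.integral_prod_right'
        (ν := volume.restrict (Set.Ioo (-ε) ε))).measurable
      exact this.comp hXmeas
    have hmain := (hfint i k).const_mul (h * (∫ v, scfK G q v))
    have hdiffint : Integrable (fun ω =>
        (∫ u in Set.Ioo (-ε) ε, scfK G q (-u / h) * fUX (X ω) u) * (X ω i * X ω k)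
        - h * (∫ v, scfK G q v) * (fUX (X ω) 0 * (X ω i * X ω k))) μ :=
      (hCint.const_mul (2 * K * h ^ 2)).mono' (hFm.aestronglyMeasurable.sub hmain.1) hest2
    have hFint : Integrable (fun ω =>
        (∫ u in Set.Ioo (-ε) ε, scfK G q (-u / h) * fUX (X ω) u) * (X ω i * X ω k)) μ := by
      refine (hdiffint.add hmain).congr (Eventually.of_forall fun ω => ?_)
      simp
    have hfin := norm_integral_le_of_norm_le (hCint.const_mul (2 * K * h ^ 2)) hest2
    rw [integral_sub hFint hmain, integral_const_mul, integral_const_mul] at hfin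
    simp_rw [hsplit]
    rw [integral_add hgint hJint, hJ, hd2, ← hκ]
    rw [Real.norm_eq_abs (h ^ 2), abs_of_nonneg (sq_nonneg h)]
    refine le_trans (le_of_eq ?_) (hfin.trans (le_of_eq ?_))
    · congr 1; ring
    · rw [hB]; ring
  · intro c
    have e : ∑ i, ∑ k, c i * (∫ ω, fUX (X ω) 0 * (X ω i * X ω k) ∂μ) * c k
        = ∫ ω, fUX (X ω) 0 * (∑ i, c i * X ω i) ^ 2 ∂μ := by
      have e1 : ∀ ω, fUX (X ω) 0 * (∑ i, c i * X ω i) ^ 2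
          = ∑ i, ∑ k, c i * (fUX (X ω) 0 * (X ω i * X ω k)) * c k := by
        intro ω
        rw [sq, Finset.sum_mul_sum, Finset.mul_sum]
        refine Finset.sum_congr rfl fun i _ => ?_
        rw [Finset.mul_sum]
        refine Finset.sum_congr rfl fun k _ => ?_
        ring
      simp_rw [e1]
      rw [integral_finsetSum _ fun i _ => integrable_finsetSum _ fun k _ =>
        ((hfint i k).const_mul _).mul_const _]
      refine Finset.sum_congr rfl fun i _ => ?_
      rw [integral_finsetSum _ fun k _ => ((hfint i k).const_mul _).mul_const _]
      refine Finset.sum_congr rfl fun k _ => ?_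
      rw [integral_mul_const, integral_const_mul]
    rw [e]
    apply integral_nonneg_of_ae
    filter_upwards [hfδ] with ω hω
    exact mul_nonneg (hδ.le.trans (hω 0 h0mem)) (sq_nonneg _)
end
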